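/- arXiv:2112.01947 — 12 statements merged into one kernel-verified Lean document; each statement's English description precedes it below -/
import Mathlib

section
/- For all positive real numbers α, β and every nonzero real number λ, the subset of ℝ⁵ given by {(e^t·y₁, e^t·y₂, e^t·y₃, e^t·y₄, −t/λ²) : t ∈ ℝ, y₁ > 0, y₁² > y₂² + y₃², y₄ > 0, (y₁² − y₂² − y₃²)^α · y₄^β = 1} is equal to the set {(x₁, x₂, x₃, x₄, −(1/((2α+β)·λ²))·(β·ln x₄ + α·ln(x₁² − (x₂² + x₃²)))) : x₁ > 0, x₁² > x₂² + x₃², x₄ > 0}. -/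
theorem rpow_mul_rpow_eq_one_iff_log {a b : ℝ} (ha : 0 < a) (hb : 0 < b) (α β : ℝ) :
    a ^ α * b ^ β = 1 ↔ β * Real.log b + α * Real.log a = 0 := by
  rw [Real.rpow_def_of_pos ha, Real.rpow_def_of_pos hb, ← Real.exp_add, Real.exp_eq_one_iff,
    mul_comm (Real.log a), mul_comm (Real.log b), add_comm]

theorem log_combination_exp_scaling {a b : ℝ} (ha : 0 < a) (hb : 0 < b) (α β t : ℝ) :
    β * Real.log (Real.exp t * b) + α * Real.log (Real.exp t ^ 2 * a) =
      (2 * α + β) * t + (β * Real.log b + α * Real.log a) := by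
  rw [Real.log_mul (Real.exp_ne_zero t) hb.ne', Real.log_mul (by positivity) ha.ne',
    Real.log_pow, Real.log_exp]
  push_cast
  ring


/-- For all positive reals `α, β` and every nonzero real `λ`, the subset of ℝ⁵
`{(eᵗy₁, eᵗy₂, eᵗy₃, eᵗy₄, −t/λ²) : t ∈ ℝ, y₁ > 0, y₁² > y₂² + y₃², y₄ > 0,
(y₁² − y₂² − y₃²)^α·y₄^β = 1}` equals
`{(x₁, x₂, x₃, x₄, −(1/((2α+β)λ²))·(β ln x₄ + α ln(x₁² − (x₂² + x₃²)))) :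
x₁ > 0, x₁² > x₂² + x₃², x₄ > 0}`. -/
theorem calabiProduct_3dim_centroaffine_point_graph
    (α β lam : ℝ) (hα : 0 < α) (hβ : 0 < β) (hlam : lam ≠ 0) :
    {p : Fin 5 → ℝ | ∃ t y₁ y₂ y₃ y₄ : ℝ, 0 < y₁ ∧ y₂ ^ 2 + y₃ ^ 2 < y₁ ^ 2 ∧ 0 < y₄ ∧
        (y₁ ^ 2 - y₂ ^ 2 - y₃ ^ 2) ^ α * y₄ ^ β = 1 ∧
        p = ![Real.exp t * y₁, Real.exp t * y₂, Real.exp t * y₃, Real.exp t * y₄,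
          -t / lam ^ 2]}
      = {p : Fin 5 → ℝ | ∃ x₁ x₂ x₃ x₄ : ℝ, 0 < x₁ ∧ x₂ ^ 2 + x₃ ^ 2 < x₁ ^ 2 ∧ 0 < x₄ ∧
        p = ![x₁, x₂, x₃, x₄,
          -(1 / ((2 * α + β) * lam ^ 2)) *
            (β * Real.log x₄ + α * Real.log (x₁ ^ 2 - (x₂ ^ 2 + x₃ ^ 2)))]} := by
  have hγ : 2 * α + β ≠ 0 := by positivity
  have hscale (s u v w : ℝ) :
      (s * u) ^ 2 - ((s * v) ^ 2 + (s * w) ^ 2) = s ^ 2 * (u ^ 2 - v ^ 2 - w ^ 2) := by ring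
  ext p
  constructor
  · rintro ⟨t, y₁, y₂, y₃, y₄, h₁, hQ, h₄, h, rfl⟩
    have hQ' : 0 < y₁ ^ 2 - y₂ ^ 2 - y₃ ^ 2 := by linarith
    refine ⟨Real.exp t * y₁, Real.exp t * y₂, Real.exp t * y₃, Real.exp t * y₄,
      by positivity, ?_, by positivity, ?_⟩
    · rw [← sub_pos, hscale]
      positivity
    · rw [hscale, log_combination_exp_scaling hQ' h₄,
        (rpow_mul_rpow_eq_one_iff_log hQ' h₄ α β).1 h]
      congr! 5
      field_simp
      ring
  · rintro ⟨x₁, x₂, x₃, x₄, h₁, hQ, h₄, rfl⟩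
    have hQ' : 0 < x₁ ^ 2 - x₂ ^ 2 - x₃ ^ 2 := by linarith
    obtain ⟨t, ht⟩ : ∃ t, (2 * α + β) * t =
        β * Real.log x₄ + α * Real.log (x₁ ^ 2 - x₂ ^ 2 - x₃ ^ 2) :=
      ⟨_, mul_div_cancel₀ _ hγ⟩
    have hcancel (x : ℝ) : Real.exp t * (Real.exp (-t) * x) = x := by
      rw [← mul_assoc, ← Real.exp_add, add_neg_cancel, Real.exp_zero, one_mul]
    have hpos : 0 < Real.exp (-t) ^ 2 * (x₁ ^ 2 - x₂ ^ 2 - x₃ ^ 2) := by positivity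
    refine ⟨t, Real.exp (-t) * x₁, Real.exp (-t) * x₂, Real.exp (-t) * x₃, Real.exp (-t) * x₄,
      by positivity, ?_, by positivity, ?_, ?_⟩
    · rwa [← sub_pos, hscale]
    · rw [sub_sub, hscale, rpow_mul_rpow_eq_one_iff_log hpos (by positivity),
        log_combination_exp_scaling hQ' h₄, ← ht]
      ring
    · rw [hcancel, hcancel, hcancel, hcancel, ← sub_sub, ← ht]
      congr! 5
      field_simp
end

section
/- For all positive real numbers α, β, γ and every nonzero real number λ, the subset of ℝ⁶ given by {(e^t·y₁, e^t·y₂, e^t·y₃, z₁, z₂, z₁² + z₂² − t/λ²) : t ∈ ℝ, z₁, z₂ ∈ ℝ, y₁ > 0, y₂ > 0, y₃ > 0, y₁^α·y₂^β·y₃^γ = 1} is equal to the graph {(x₁,…,x₅, f(x₁,…,x₅)) : x₁ > 0, x₂ > 0, x₃ > 0, x₄, x₅ ∈ ℝ} of the function f(x₁,…,x₅) = −(1/((α+β+γ)·λ²))·(α·ln x₁ + β·ln x₂ + γ·ln x₃) + x₄² + x₅². -/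
theorem rpow_mul_rpow_mul_rpow_eq_one_iff {a b c x y z : ℝ}
    (hx : 0 < x) (hy : 0 < y) (hz : 0 < z) :
    x ^ a * y ^ b * z ^ c = 1 ↔ a * Real.log x + b * Real.log y + c * Real.log z = 0 := by
  rw [Real.rpow_def_of_pos hx, Real.rpow_def_of_pos hy, Real.rpow_def_of_pos hz,
    ← Real.exp_add, ← Real.exp_add, Real.exp_eq_one_iff]
  simp only [mul_comm]

theorem log_exp_mul {t x : ℝ} (hx : 0 < x) : Real.log (Real.exp t * x) = t + Real.log x := by
  rw [Real.log_mul (Real.exp_ne_zero t) hx.ne', Real.log_exp]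

/-- For all positive reals `α, β, γ` and every nonzero real `λ`, the subset of ℝ⁶
`{(eᵗy₁, eᵗy₂, eᵗy₃, z₁, z₂, z₁² + z₂² − t/λ²) : t, z₁, z₂ ∈ ℝ, y₁,y₂,y₃ > 0,
y₁^α·y₂^β·y₃^γ = 1}` equals the graph of
`f(x₁,…,x₅) = −(1/((α+β+γ)λ²))·(α ln x₁ + β ln x₂ + γ ln x₃) + x₄² + x₅²`. -/
theorem calabiProduct_centroaffine_surface_paraboloid_graph
    (α β γ lam : ℝ) (hα : 0 < α) (hβ : 0 < β) (hγ : 0 < γ) (hlam : lam ≠ 0) :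
    {p : Fin 6 → ℝ | ∃ t z₁ z₂ y₁ y₂ y₃ : ℝ, 0 < y₁ ∧ 0 < y₂ ∧ 0 < y₃ ∧
        y₁ ^ α * y₂ ^ β * y₃ ^ γ = 1 ∧
        p = ![Real.exp t * y₁, Real.exp t * y₂, Real.exp t * y₃, z₁, z₂,
          z₁ ^ 2 + z₂ ^ 2 - t / lam ^ 2]}
      = {p : Fin 6 → ℝ | ∃ x₁ x₂ x₃ x₄ x₅ : ℝ, 0 < x₁ ∧ 0 < x₂ ∧ 0 < x₃ ∧
        p = ![x₁, x₂, x₃, x₄, x₅,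
          -(1 / ((α + β + γ) * lam ^ 2)) *
              (α * Real.log x₁ + β * Real.log x₂ + γ * Real.log x₃)
            + x₄ ^ 2 + x₅ ^ 2]} := by
  have hs : α + β + γ ≠ 0 := by positivity
  ext p
  constructor
  · rintro ⟨t, z₁, z₂, y₁, y₂, y₃, h₁, h₂, h₃, h, rfl⟩
    rw [rpow_mul_rpow_mul_rpow_eq_one_iff h₁ h₂ h₃] at h
    refine ⟨Real.exp t * y₁, Real.exp t * y₂, Real.exp t * y₃, z₁, z₂,
      by positivity, by positivity, by positivity, ?_⟩
    have hsum : α * (t + Real.log y₁) + β * (t + Real.log y₂) + γ * (t + Real.log y₃)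
        = (α + β + γ) * t := by linear_combination h
    rw [log_exp_mul h₁, log_exp_mul h₂, log_exp_mul h₃, hsum]
    congr! 6
    field_simp
    ring
  · rintro ⟨x₁, x₂, x₃, x₄, x₅, h₁, h₂, h₃, rfl⟩
    obtain ⟨t, ht⟩ : ∃ t, α * Real.log x₁ + β * Real.log x₂ + γ * Real.log x₃
        = (α + β + γ) * t := ⟨_, (mul_div_cancel₀ _ hs).symm⟩
    have hexp (x : ℝ) : Real.exp t * (Real.exp (-t) * x) = x := by
      rw [← mul_assoc, ← Real.exp_add, add_neg_cancel, Real.exp_zero, one_mul]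
    refine ⟨t, x₄, x₅, Real.exp (-t) * x₁, Real.exp (-t) * x₂, Real.exp (-t) * x₃,
      by positivity, by positivity, by positivity, ?_, ?_⟩
    · rw [rpow_mul_rpow_mul_rpow_eq_one_iff (by positivity) (by positivity) (by positivity),
        log_exp_mul h₁, log_exp_mul h₂, log_exp_mul h₃]
      linear_combination ht
    · rw [hexp, hexp, hexp, ht]
      congr! 6
      field_simp
      ring
end

section
/- Let E be a finite-dimensional real inner product space of dimension n ≥ 1 and let A : E × E × E → ℝ be a symmetric trilinear form. Then there exist an orthonormal basis {e₁, …, eₙ} of E and real numbers μ₁, …, μₙ such that: (a) the function F(v) = A(v,v,v) attains its maximum over the unit sphere {v ∈ E : ⟪v,v⟫ = 1} at e₁, with maximum value μ₁ = A(e₁,e₁,e₁); (b) A(e₁, e_i, e_j) = μ_i·δ_{ij} for all 1 ≤ i, j ≤ n; (c) μ₁ ≥ 2·μ_i for every i ≥ 2; and (d) for every i ≥ 2, if μ₁ = 2·μ_i then A(e_i, e_i, e_i) = 0. -/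
open scoped RealInnerProductSpace

theorem eq_zero_of_forall_nonneg_mul {g : ℝ → ℝ} (hg : Continuous g)
    (h : ∀ s, 0 ≤ s * g s) : g 0 = 0 := by
  refine le_antisymm ?_ ?_
  · have hlim : Filter.Tendsto g (nhdsWithin 0 (Set.Iio 0)) (nhds (g 0)) :=
      hg.continuousAt.continuousWithinAt
    refine le_of_tendsto hlim ?_
    filter_upwards [self_mem_nhdsWithin] with s hs
    exact nonpos_of_mul_nonneg_right (h s) hs
  · have hlim : Filter.Tendsto g (nhdsWithin 0 (Set.Ioi 0)) (nhds (g 0)) :=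
      hg.continuousAt.continuousWithinAt
    refine ge_of_tendsto hlim ?_
    filter_upwards [self_mem_nhdsWithin] with s hs
    exact nonneg_of_mul_nonneg_right (h s) hs

theorem nonneg_of_forall_nonneg_sq_mul {g : ℝ → ℝ} (hg : Continuous g)
    (h : ∀ s, 0 ≤ s ^ 2 * g s) : 0 ≤ g 0 := by
  have hlim : Filter.Tendsto g (nhdsWithin 0 (Set.Ioi 0)) (nhds (g 0)) :=
    hg.continuousAt.continuousWithinAt
  refine ge_of_tendsto hlim ?_
  filter_upwards [self_mem_nhdsWithin] with s hs
  exact nonneg_of_mul_nonneg_right (h s) (pow_pos hs 2)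

/-- Optimality conditions at `(1, 0)` for the binary cubic form
`M x ^ 3 + 3 a x ^ 2 y + 3 b x y ^ 2 + c y ^ 3` maximized over the unit circle. -/
theorem binary_cubic_optimality {M a b c : ℝ}
    (h : ∀ x y : ℝ, x ^ 2 + y ^ 2 = 1 →
      M * x ^ 3 + 3 * a * x ^ 2 * y + 3 * b * x * y ^ 2 + c * y ^ 3 ≤ M) :
    a = 0 ∧ 2 * b ≤ M ∧ (M = 2 * b → c = 0) := by
  have key : ∀ s : ℝ, 0 ≤ 2 * M * s ^ 6 + 6 * M * s ^ 2
      - 6 * a * s * (1 - s ^ 2) ^ 2 - 12 * b * s ^ 2 * (1 - s ^ 2) - 8 * c * s ^ 3 := by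
    intro s
    have hs : 0 < 1 + s ^ 2 := by positivity
    have h1 := h ((1 - s ^ 2) / (1 + s ^ 2)) (2 * s / (1 + s ^ 2)) (by field_simp; ring)
    have h2 := mul_le_mul_of_nonneg_right h1 (pow_pos hs 3).le
    have h3 : (M * ((1 - s ^ 2) / (1 + s ^ 2)) ^ 3
        + 3 * a * ((1 - s ^ 2) / (1 + s ^ 2)) ^ 2 * (2 * s / (1 + s ^ 2))
        + 3 * b * ((1 - s ^ 2) / (1 + s ^ 2)) * (2 * s / (1 + s ^ 2)) ^ 2
        + c * (2 * s / (1 + s ^ 2)) ^ 3) * (1 + s ^ 2) ^ 3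
        = M * (1 - s ^ 2) ^ 3 + 6 * a * s * (1 - s ^ 2) ^ 2
          + 12 * b * s ^ 2 * (1 - s ^ 2) + 8 * c * s ^ 3 := by
      field_simp
      ring
    rw [h3] at h2
    linear_combination h2
  have ha : a = 0 := by
    have := eq_zero_of_forall_nonneg_mul
      (g := fun s ↦ 2 * M * s ^ 5 + 6 * M * s - 6 * a * (1 - s ^ 2) ^ 2
        - 12 * b * s * (1 - s ^ 2) - 8 * c * s ^ 2) (by fun_prop)
      (fun s ↦ by linear_combination key s)
    norm_num at this
    exact this
  subst ha
  refine ⟨rfl, ?_, ?_⟩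
  · have := nonneg_of_forall_nonneg_sq_mul
      (g := fun s ↦ 2 * M * s ^ 4 + 6 * M - 12 * b * (1 - s ^ 2) - 8 * c * s) (by fun_prop)
      (fun s ↦ by linear_combination key s)
    norm_num at this
    linarith
  · rintro rfl
    have := eq_zero_of_forall_nonneg_mul
      (g := fun s ↦ 4 * b * s ^ 3 + 12 * b * s - 8 * c) (by fun_prop) (fun s ↦ by
        rcases eq_or_ne s 0 with rfl | hs
        · simp
        · refine nonneg_of_mul_nonneg_right (a := s ^ 2) ?_ (by positivity)
          linear_combination key s)
    norm_num at this
    exact this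

/-- A symmetric bilinear form on a finite-dimensional Euclidean space is diagonal in some
orthonormal basis. -/
theorem LinearMap.exists_orthonormalBasis_apply_eq_zero
    {E : Type*} [NormedAddCommGroup E] [InnerProductSpace ℝ E] [FiniteDimensional ℝ E]
    {n : ℕ} (hdim : Module.finrank ℝ E = n) (B : E →ₗ[ℝ] E →ₗ[ℝ] ℝ)
    (hB : ∀ x y, B x y = B y x) :
    ∃ b : OrthonormalBasis (Fin n) ℝ E, ∀ i j, i ≠ j → B (b i) (b j) = 0 := by
  let T : E →ₗ[ℝ] E := (InnerProductSpace.toDual ℝ E).symm.toLinearEquiv.toLinearMap ∘ₗ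
    LinearMap.toContinuousLinearMap.toLinearMap ∘ₗ B
  have hT : ∀ x y, ⟪T x, y⟫ = B x y := fun x y ↦ by simp [T]
  have hsymm : T.IsSymmetric := fun x y ↦ by
    rw [hT, real_inner_comm, hT, hB]
  refine ⟨hsymm.eigenvectorBasis hdim, fun i j hij ↦ ?_⟩
  rw [← hT, hsymm.apply_eigenvectorBasis, real_inner_smul_left,
    (hsymm.eigenvectorBasis hdim).inner_eq_zero hij, mul_zero]

/-- A symmetric bilinear form on a finite-dimensional Euclidean space for which the unit vector
`u` is orthogonal to `uᗮ` is diagonal in some orthonormal basis starting with `u`. -/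
theorem LinearMap.exists_orthonormalBasis_zero_eq_of_apply_eq_zero
    {E : Type*} [NormedAddCommGroup E] [InnerProductSpace ℝ E] [FiniteDimensional ℝ E]
    {m : ℕ} (hdim : Module.finrank ℝ E = m + 1) (B : E →ₗ[ℝ] E →ₗ[ℝ] ℝ)
    (hB : ∀ x y, B x y = B y x) {u : E} (hu : ‖u‖ = 1) (hBu : ∀ w, ⟪u, w⟫ = 0 → B u w = 0) :
    ∃ b : OrthonormalBasis (Fin (m + 1)) ℝ E, b 0 = u ∧ ∀ i j, i ≠ j → B (b i) (b j) = 0 := by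
  have hu0 : u ≠ 0 := by
    rintro rfl
    simp at hu
  have : Fact (Module.finrank ℝ E = m + 1) := ⟨hdim⟩
  obtain ⟨b', hb'⟩ := LinearMap.exists_orthonormalBasis_apply_eq_zero
    (E := ((ℝ ∙ u)ᗮ : Submodule ℝ E)) (Submodule.finrank_orthogonal_span_singleton (n := m) hu0)
    (B.domRestrict₁₂ _ _) (fun x y ↦ hB x y)
  have hperp : ∀ i, ⟪u, (b' i : E)⟫ = 0 := fun i ↦
    Submodule.mem_orthogonal_singleton_iff_inner_right.1 (b' i).2
  let v : Fin (m + 1) → E := Fin.cons u (fun i ↦ (b' i : E))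
  have hv : Orthonormal ℝ v := by
    refine ⟨fun i ↦ ?_, fun i j hij ↦ ?_⟩
    · cases i using Fin.cases with
      | zero => exact hu
      | succ i => exact b'.orthonormal.1 i
    · cases i using Fin.cases with
      | zero =>
        cases j using Fin.cases with
        | zero => exact absurd rfl hij
        | succ j => exact hperp j
      | succ i =>
        cases j using Fin.cases with
        | zero => exact (real_inner_comm _ _).trans (hperp i)
        | succ j => exact b'.orthonormal.2 fun h ↦ hij (congrArg Fin.succ h)
  obtain ⟨b, hb⟩ := Orthonormal.exists_orthonormalBasis_extension_of_card_eq
    (s := Set.univ) (v := v) (by simpa using hdim) (hv.comp _ Subtype.val_injective)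
  refine ⟨b, hb 0 trivial, fun i j hij ↦ ?_⟩
  rw [hb i trivial, hb j trivial]
  cases i using Fin.cases with
  | zero =>
    cases j using Fin.cases with
    | zero => exact absurd rfl hij
    | succ j => exact hBu _ (hperp j)
  | succ i =>
    cases j using Fin.cases with
    | zero => exact (hB _ _).trans (hBu _ (hperp i))
    | succ j => exact hb' i j fun h ↦ hij (congrArg Fin.succ h)

theorem LinearMap.exists_norm_eq_one_forall_cubic_le
    {E : Type*} [NormedAddCommGroup E] [InnerProductSpace ℝ E] [FiniteDimensional ℝ E]
    [Nontrivial E] (A : E →ₗ[ℝ] E →ₗ[ℝ] E →ₗ[ℝ] ℝ) :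
    ∃ u : E, ‖u‖ = 1 ∧ ∀ v : E, ‖v‖ = 1 → A v v v ≤ A u u u := by
  have hcont : Continuous fun v : E ↦ A v v v := by
    let b := Module.finBasis ℝ E
    have hA : (fun v : E ↦ A v v v) = fun v ↦ ∑ i, ∑ j, ∑ k,
        b.repr v i * (b.repr v j * (b.repr v k * A (b i) (b k) (b j))) := by
      funext v
      conv_lhs => rw [← b.sum_repr v]
      simp only [map_sum, map_smul, LinearMap.sum_apply, LinearMap.smul_apply, smul_eq_mul,
        Finset.mul_sum]
      rw [Finset.sum_comm_cycle]
      refine Finset.sum_congr rfl fun i _ ↦ ?_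
      refine Finset.sum_congr rfl fun j _ ↦ Finset.sum_congr rfl fun k _ ↦ ?_
      ring
    have hrepr : ∀ i, Continuous fun v ↦ b.repr v i := fun i ↦
      (b.coord i).continuous_of_finiteDimensional
    rw [hA]
    fun_prop
  obtain ⟨u, hu, hmax⟩ := (isCompact_sphere (0 : E) 1).exists_isMaxOn
    (NormedSpace.sphere_nonempty.2 zero_le_one) hcont.continuousOn
  exact ⟨u, by simpa using hu, fun v hv ↦ hmax (by simpa using hv)⟩

theorem LinearMap.cubic_optimality
    {E : Type*} [NormedAddCommGroup E] [InnerProductSpace ℝ E]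
    {A : E →ₗ[ℝ] E →ₗ[ℝ] E →ₗ[ℝ] ℝ}
    (hsymm₁ : ∀ x y z : E, A x y z = A y x z)
    (hsymm₂ : ∀ x y z : E, A x y z = A x z y) {u w : E} (hu : ‖u‖ = 1) (hw : ‖w‖ = 1)
    (huw : ⟪u, w⟫ = 0) (hmax : ∀ v : E, ‖v‖ = 1 → A v v v ≤ A u u u) :
    A u u w = 0 ∧ 2 * A u w w ≤ A u u u ∧ (A u u u = 2 * A u w w → A w w w = 0) := by
  refine binary_cubic_optimality fun x y hxy ↦ ?_
  have hnorm : ‖x • u + y • w‖ = 1 := by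
    rw [← sq_eq_sq₀ (norm_nonneg _) zero_le_one, norm_add_sq_real, norm_smul, norm_smul,
      real_inner_smul_left, real_inner_smul_right, huw, hu, hw]
    simpa using hxy
  have h := hmax _ hnorm
  simp only [map_add, map_smul, LinearMap.add_apply, LinearMap.smul_apply, smul_eq_mul] at h
  rw [hsymm₁ w u u, hsymm₂ u w u, hsymm₁ w u w, hsymm₂ w w u, hsymm₁ w u w] at h
  linear_combination h

open scoped RealInnerProductSpace

/-- Lemma 4.1, typical orthonormal basis: for a symmetric trilinear form `A` on a
finite-dimensional real inner product space `E` of dimension `n ≥ 1` there is an orthonormal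
basis `{e₁,…,eₙ}` and reals `μ₁,…,μₙ` with: (a) `F(v) = A(v,v,v)` attains its maximum over the
unit sphere at `e₁`, with value `μ₁ = A(e₁,e₁,e₁)`; (b) `A(e₁,eᵢ,eⱼ) = μᵢ δᵢⱼ`;
(c) `μ₁ ≥ 2μᵢ` for `i ≥ 2`; (d) if `μ₁ = 2μᵢ` for some `i ≥ 2` then `A(eᵢ,eᵢ,eᵢ) = 0`. -/
theorem exists_typical_orthonormal_basis
    {E : Type*} [NormedAddCommGroup E] [InnerProductSpace ℝ E] [FiniteDimensional ℝ E]
    (n : ℕ) (hn : 0 < n) (hdim : Module.finrank ℝ E = n)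
    (A : E →ₗ[ℝ] E →ₗ[ℝ] E →ₗ[ℝ] ℝ)
    (hsymm₁ : ∀ x y z : E, A x y z = A y x z)
    (hsymm₂ : ∀ x y z : E, A x y z = A x z y) :
    ∃ (e : OrthonormalBasis (Fin n) ℝ E) (μ : Fin n → ℝ),
      (μ ⟨0, hn⟩ = A (e ⟨0, hn⟩) (e ⟨0, hn⟩) (e ⟨0, hn⟩) ∧
        ∀ v : E, ⟪v, v⟫ = 1 → A v v v ≤ μ ⟨0, hn⟩) ∧
      (∀ i j : Fin n, A (e ⟨0, hn⟩) (e i) (e j) = if i = j then μ i else 0) ∧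
      (∀ i : Fin n, i ≠ ⟨0, hn⟩ → 2 * μ i ≤ μ ⟨0, hn⟩) ∧
      (∀ i : Fin n, i ≠ ⟨0, hn⟩ → μ ⟨0, hn⟩ = 2 * μ i → A (e i) (e i) (e i) = 0) := by
  obtain ⟨m, rfl⟩ : ∃ m, n = m + 1 := ⟨n - 1, by omega⟩
  have : Nontrivial E := Module.nontrivial_of_finrank_pos (R := ℝ) (by omega)
  obtain ⟨u, hu, hmax⟩ := LinearMap.exists_norm_eq_one_forall_cubic_le A
  have hAu : ∀ w, ⟪u, w⟫ = 0 → A u u w = 0 := by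
    intro w hw
    rcases eq_or_ne w 0 with rfl | hw0
    · simp
    have h := (LinearMap.cubic_optimality hsymm₁ hsymm₂ hu (norm_smul_inv_norm (𝕜 := ℝ) hw0)
      (by simp [real_inner_smul_right, hw]) hmax).1
    simpa [hw0] using h
  obtain ⟨e, rfl, he⟩ := LinearMap.exists_orthonormalBasis_zero_eq_of_apply_eq_zero hdim (A u)
    (hsymm₂ u) hu hAu
  have hopt : ∀ i : Fin (m + 1), i ≠ 0 → _ := fun i hi ↦
    LinearMap.cubic_optimality hsymm₁ hsymm₂ hu (e.orthonormal.1 i)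
      (e.inner_eq_zero hi.symm) hmax
  refine ⟨e, fun i ↦ A (e 0) (e i) (e i), ⟨rfl, fun v hv ↦ hmax v ?_⟩, fun i j ↦ ?_,
    fun i hi ↦ (hopt i hi).2.1, fun i hi ↦ (hopt i hi).2.2⟩
  · rw [norm_eq_sqrt_real_inner, hv, Real.sqrt_one]
  · split_ifs with hij
    · subst hij
      rfl
    · exact he i j hij
end

section
/- Let E and F be real inner product spaces, μ₁ a positive real number, and L : E × E → F a symmetric bilinear map that is isotropic, i.e., ⟪L(v,v), L(v,v)⟫ = (μ₁²/4)·⟪v,v⟫² for all v ∈ E. Then for all orthonormal vectors v₁, v₂, v₃, v₄ ∈ E: (a) ⟪L(v₁,v₁), L(v₁,v₂)⟫ = 0; (b) ⟪L(v₁,v₁), L(v₂,v₂)⟫ + 2·⟪L(v₁,v₂), L(v₁,v₂)⟫ = μ₁²/4; (c) ⟪L(v₁,v₁), L(v₂,v₃)⟫ + 2·⟪L(v₁,v₂), L(v₁,v₃)⟫ = 0; (d) ⟪L(v₁,v₂), L(v₃,v₄)⟫ + ⟪L(v₁,v₃), L(v₂,v₄)⟫ + ⟪L(v₁,v₄), L(v₂,v₃)⟫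 = 0. -/
open scoped RealInnerProductSpace

/-- First polarization of the isotropy identity. -/
theorem inner_apply_self_apply_of_isotropic
    {E F : Type*} [NormedAddCommGroup E] [InnerProductSpace ℝ E]
    [NormedAddCommGroup F] [InnerProductSpace ℝ F] {k : ℝ}
    {L : E →ₗ[ℝ] E →ₗ[ℝ] F} (hsymm : ∀ v w : E, L v w = L w v)
    (hiso : ∀ v : E, ⟪L v v, L v v⟫ = k * ⟪v, v⟫ ^ 2) (v w : E) :
    ⟪L v v, L v w⟫ = k * (⟪v, v⟫ * ⟪v, w⟫) := by
  have h₁ := hiso (v + w)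
  have h₂ := hiso (v - w)
  have h₃ := hiso (v + (2 : ℝ) • w)
  have h₄ := hiso (v - (2 : ℝ) • w)
  simp only [map_add, map_sub, map_smul, LinearMap.add_apply, LinearMap.sub_apply,
    LinearMap.smul_apply, inner_add_left, inner_add_right, inner_sub_left, inner_sub_right,
    real_inner_smul_left, real_inner_smul_right, hsymm w v, real_inner_comm v w,
    real_inner_comm (L v v) (L v w), real_inner_comm (L v v) (L w w),
    real_inner_comm (L v w) (L w w)] at h₁ h₂ h₃ h₄
  linear_combination (h₁ - h₂) / 6 - (h₃ - h₄) / 48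

/-- Second polarization of the isotropy identity. -/
theorem inner_apply_self_add_two_mul_of_isotropic
    {E F : Type*} [NormedAddCommGroup E] [InnerProductSpace ℝ E]
    [NormedAddCommGroup F] [InnerProductSpace ℝ F] {k : ℝ}
    {L : E →ₗ[ℝ] E →ₗ[ℝ] F} (hsymm : ∀ v w : E, L v w = L w v)
    (hiso : ∀ v : E, ⟪L v v, L v v⟫ = k * ⟪v, v⟫ ^ 2) (u v w : E) :
    ⟪L u u, L v w⟫ + 2 * ⟪L u v, L u w⟫ =
      k * (⟪u, u⟫ * ⟪v, w⟫ + 2 * (⟪u, v⟫ * ⟪u, w⟫)) := by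
  have h₁ := inner_apply_self_apply_of_isotropic hsymm hiso (v + u) w
  have h₂ := inner_apply_self_apply_of_isotropic hsymm hiso (v - u) w
  have h₃ := inner_apply_self_apply_of_isotropic hsymm hiso v w
  simp only [map_add, map_sub, LinearMap.add_apply, LinearMap.sub_apply, inner_add_left,
    inner_add_right, inner_sub_left, inner_sub_right, hsymm v u, real_inner_comm u v]
    at h₁ h₂
  linear_combination (h₁ + h₂) / 2 - h₃

/-- Full polarization of the isotropy identity. -/
theorem inner_apply_add_inner_apply_add_inner_apply_of_isotropic
    {E F : Type*} [NormedAddCommGroup E] [InnerProductSpace ℝ E]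
    [NormedAddCommGroup F] [InnerProductSpace ℝ F] {k : ℝ}
    {L : E →ₗ[ℝ] E →ₗ[ℝ] F} (hsymm : ∀ v w : E, L v w = L w v)
    (hiso : ∀ v : E, ⟪L v v, L v v⟫ = k * ⟪v, v⟫ ^ 2) (a b c d : E) :
    ⟪L a b, L c d⟫ + ⟪L a c, L b d⟫ + ⟪L a d, L b c⟫ =
      k * (⟪a, b⟫ * ⟪c, d⟫ + ⟪a, c⟫ * ⟪b, d⟫ + ⟪a, d⟫ * ⟪b, c⟫) := by
  have h₁ := inner_apply_self_add_two_mul_of_isotropic hsymm hiso (a + b) c d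
  have h₂ := inner_apply_self_add_two_mul_of_isotropic hsymm hiso a c d
  have h₃ := inner_apply_self_add_two_mul_of_isotropic hsymm hiso b c d
  simp only [map_add, LinearMap.add_apply, inner_add_left, inner_add_right, hsymm b a,
    real_inner_comm a b, real_inner_comm (L a d) (L b c)] at h₁
  linear_combination (h₁ - h₂ - h₃) / 2

/-- Lemma 5.3, relations (5.5)–(5.8): for an isotropic symmetric bilinear map
`L : E × E → F` with isotropy constant `μ₁²/4` and orthonormal vectors `v₁,v₂,v₃,v₄`:
(a) `⟪L(v₁,v₁),L(v₁,v₂)⟫ = 0`;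
(b) `⟪L(v₁,v₁),L(v₂,v₂)⟫ + 2⟪L(v₁,v₂),L(v₁,v₂)⟫ = μ₁²/4`;
(c) `⟪L(v₁,v₁),L(v₂,v₃)⟫ + 2⟪L(v₁,v₂),L(v₁,v₃)⟫ = 0`;
(d) `⟪L(v₁,v₂),L(v₃,v₄)⟫ + ⟪L(v₁,v₃),L(v₂,v₄)⟫ + ⟪L(v₁,v₄),L(v₂,v₃)⟫ = 0`. -/
theorem isotropic_bilinear_map_orthonormal_relations
    {E F : Type*} [NormedAddCommGroup E] [InnerProductSpace ℝ E]
    [NormedAddCommGroup F] [InnerProductSpace ℝ F]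
    (μ₁ : ℝ) (hμ₁ : 0 < μ₁)
    (L : E →ₗ[ℝ] E →ₗ[ℝ] F) (hsymm : ∀ v w : E, L v w = L w v)
    (hiso : ∀ v : E, ⟪L v v, L v v⟫ = (μ₁ ^ 2 / 4) * ⟪v, v⟫ ^ 2) :
    ∀ v₁ v₂ v₃ v₄ : E, Orthonormal ℝ ![v₁, v₂, v₃, v₄] →
      ⟪L v₁ v₁, L v₁ v₂⟫ = 0 ∧
      ⟪L v₁ v₁, L v₂ v₂⟫ + 2 * ⟪L v₁ v₂, L v₁ v₂⟫ = μ₁ ^ 2 / 4 ∧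
      ⟪L v₁ v₁, L v₂ v₃⟫ + 2 * ⟪L v₁ v₂, L v₁ v₃⟫ = 0 ∧
      ⟪L v₁ v₂, L v₃ v₄⟫ + ⟪L v₁ v₃, L v₂ v₄⟫ + ⟪L v₁ v₄, L v₂ v₃⟫ = 0 := by
  intro v₁ v₂ v₃ v₄ hv
  have h₁₁ : ⟪v₁, v₁⟫ = 1 := inner_self_eq_one_of_norm_eq_one (hv.1 0)
  have h₂₂ : ⟪v₂, v₂⟫ = 1 := inner_self_eq_one_of_norm_eq_one (hv.1 1)
  have h₁₂ : ⟪v₁, v₂⟫ = 0 := hv.2 (show (0 : Fin 4) ≠ 1 by decide)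
  have h₁₃ : ⟪v₁, v₃⟫ = 0 := hv.2 (show (0 : Fin 4) ≠ 2 by decide)
  have h₁₄ : ⟪v₁, v₄⟫ = 0 := hv.2 (show (0 : Fin 4) ≠ 3 by decide)
  have h₂₃ : ⟪v₂, v₃⟫ = 0 := hv.2 (show (1 : Fin 4) ≠ 2 by decide)
  refine ⟨?_, ?_, ?_, ?_⟩
  · simp [inner_apply_self_apply_of_isotropic hsymm hiso, h₁₂]
  · rw [inner_apply_self_add_two_mul_of_isotropic hsymm hiso, h₁₁, h₂₂, h₁₂]
    ring
  · simp [inner_apply_self_add_two_mul_of_isotropic hsymm hiso, h₁₂, h₂₃]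
  · simp [inner_apply_add_inner_apply_add_inner_apply_of_isotropic hsymm hiso, h₁₂, h₁₃, h₁₄]
end

section
/- Let E and F be finite-dimensional real inner product spaces with dim E ≥ 2, let μ₁ > 0, and let L : E × E → F be a symmetric bilinear map that is isotropic with constant μ₁²/4 and satisfies identity (5.14). Then for every orthonormal basis {u₁, …, u_{m−1}} of E and all indices p ≠ j: 0 = ( (1/2)μ₁² − 4·⟪L(u_j,u_p), L(u_j,u_p)⟫ )·L(u_j,u_p) − 4·∑_{i ≠ p} ⟪L(u_j,u_i), L(u_j,u_p)⟫·L(u_j,u_i). In particular, if L(u₁,u₂) ≠ 0 and ⟪L(u₁,u_i), L(u₁,u₂)⟫ = 0 for all i ≠ 2, then ⟪L(u₁,u₂), L(u₁,u₂)⟫ = μ₁²/8. -/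
open scoped RealInnerProductSpace

section Polarization

variable {E F : Type*} [NormedAddCommGroup E] [InnerProductSpace ℝ E]
  [NormedAddCommGroup F] [InnerProductSpace ℝ F]

/-- Polarization of the isotropy condition in two of its four arguments. -/
theorem inner_self_add_two_mul_inner_of_isotropic {c : ℝ} {L : E →ₗ[ℝ] E →ₗ[ℝ] F}
    (hsymm : ∀ v w : E, L v w = L w v)
    (hiso : ∀ v : E, ⟪L v v, L v v⟫ = c * ⟪v, v⟫ ^ 2) (u w : E) :
    ⟪L u u, L w w⟫ + 2 * ⟪L u w, L u w⟫ = c * (⟪u, u⟫ * ⟪w, w⟫ + 2 * ⟪u, w⟫ ^ 2) := by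
  have hadd := hiso (u + w)
  have hsub := hiso (u - w)
  simp only [map_add, map_sub, LinearMap.add_apply, LinearMap.sub_apply, inner_add_left,
    inner_add_right, inner_sub_left, inner_sub_right, hsymm w u, real_inner_comm u w,
    real_inner_comm (L u u) (L u w), real_inner_comm (L u u) (L w w),
    real_inner_comm (L u w) (L w w)] at hadd hsub
  linear_combination (1 / 4) * hadd + (1 / 4) * hsub - (1 / 2) * hiso u - (1 / 2) * hiso w

/-- Polarization of the isotropy condition in three of its four arguments. -/
theorem inner_add_two_mul_inner_of_isotropic {c : ℝ} {L : E →ₗ[ℝ] E →ₗ[ℝ] F}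
    (hsymm : ∀ v w : E, L v w = L w v)
    (hiso : ∀ v : E, ⟪L v v, L v v⟫ = c * ⟪v, v⟫ ^ 2) (u v w : E) :
    ⟪L u u, L v w⟫ + 2 * ⟪L u v, L u w⟫ = c * (⟪u, u⟫ * ⟪v, w⟫ + 2 * (⟪u, v⟫ * ⟪u, w⟫)) := by
  have h := inner_self_add_two_mul_inner_of_isotropic hsymm hiso u (v + w)
  simp only [map_add, LinearMap.add_apply, inner_add_left, inner_add_right, hsymm w v,
    real_inner_comm v w, real_inner_comm (L u v) (L u w)] at h
  linear_combination (1 / 2) * h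
    - (1 / 2) * inner_self_add_two_mul_inner_of_isotropic hsymm hiso u v
    - (1 / 2) * inner_self_add_two_mul_inner_of_isotropic hsymm hiso u w

end Polarization

/-- Lemma 5.6, (5.12) and (5.13): for an isotropic symmetric bilinear map
`L : E × E → F` (isotropy constant `μ₁²/4`, `dim E ≥ 2`) satisfying identity (5.14), for every
orthonormal basis `{u_i}` of `E` and `p ≠ j`:
`0 = ((1/2)μ₁² − 4⟪L(u_j,u_p),L(u_j,u_p)⟫)L(u_j,u_p)
   − ∑_{i ≠ p} 4⟪L(u_j,u_i),L(u_j,u_p)⟫ L(u_j,u_i)`;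
in particular if `L(u_j,u_p) ≠ 0` is orthogonal to all `L(u_j,u_i)`, `i ≠ p`, then
`⟪L(u_j,u_p),L(u_j,u_p)⟫ = μ₁²/8`. -/
theorem isotropic_bilinear_map_eigen_relation
    {E F : Type*} [NormedAddCommGroup E] [InnerProductSpace ℝ E] [FiniteDimensional ℝ E]
    [NormedAddCommGroup F] [InnerProductSpace ℝ F] [FiniteDimensional ℝ F]
    (hdim : 2 ≤ Module.finrank ℝ E)
    (μ₁ : ℝ) (hμ₁ : 0 < μ₁)
    (L : E →ₗ[ℝ] E →ₗ[ℝ] F) (hsymm : ∀ v w : E, L v w = L w v)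
    (hiso : ∀ v : E, ⟪L v v, L v v⟫ = (μ₁ ^ 2 / 4) * ⟪v, v⟫ ^ 2)
    (h514 : ∀ (b : OrthonormalBasis (Fin (Module.finrank ℝ E)) ℝ E) (v₁ v₂ v₃ v₄ : E),
      ∑ i, (⟪L v₁ (b i), L v₃ v₄⟫ • L v₂ (b i) + ⟪L v₂ (b i), L v₃ v₄⟫ • L v₁ (b i)
        - ⟪L v₃ (b i), L v₁ v₂⟫ • L v₄ (b i) - ⟪L v₄ (b i), L v₁ v₂⟫ • L v₃ (b i)) = 0) :
    (∀ (b : OrthonormalBasis (Fin (Module.finrank ℝ E)) ℝ E)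
        (j p : Fin (Module.finrank ℝ E)), p ≠ j →
      (0 : F) = ((1 / 2) * μ₁ ^ 2 - 4 * ⟪L (b j) (b p), L (b j) (b p)⟫) • L (b j) (b p)
        - ∑ i ∈ Finset.univ.filter (fun i => i ≠ p),
            (4 * ⟪L (b j) (b i), L (b j) (b p)⟫) • L (b j) (b i)) ∧
    (∀ (b : OrthonormalBasis (Fin (Module.finrank ℝ E)) ℝ E)
        (j p : Fin (Module.finrank ℝ E)), p ≠ j →
      L (b j) (b p) ≠ 0 →
      (∀ i, i ≠ p → ⟪L (b j) (b i), L (b j) (b p)⟫ = 0) →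
      ⟪L (b j) (b p), L (b j) (b p)⟫ = μ₁ ^ 2 / 8) := by
  have key : ∀ (b : OrthonormalBasis (Fin (Module.finrank ℝ E)) ℝ E)
      (j p : Fin (Module.finrank ℝ E)), p ≠ j →
      (0 : F) = ((1 / 2) * μ₁ ^ 2 - 4 * ⟪L (b j) (b p), L (b j) (b p)⟫) • L (b j) (b p)
        - ∑ i ∈ Finset.univ.filter (fun i => i ≠ p),
            (4 * ⟪L (b j) (b i), L (b j) (b p)⟫) • L (b j) (b i) := by
    intro b j p hpj
    have hb (i k) : ⟪b i, b k⟫ = if i = k then (1 : ℝ) else 0 :=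
      orthonormal_iff_ite.mp b.orthonormal i k
    have hj (i) : ⟪L (b j) (b i), L (b j) (b j)⟫ = if j = i then μ₁ ^ 2 / 4 else 0 := by
      have h := inner_add_two_mul_inner_of_isotropic hsymm hiso (b j) (b j) (b i)
      rw [real_inner_comm]
      simp only [hb] at h
      split_ifs at h ⊢ <;> linarith
    have hp (i) : ⟪L (b p) (b i), L (b j) (b j)⟫ =
        (if p = i then μ₁ ^ 2 / 4 else 0) - 2 * ⟪L (b j) (b i), L (b j) (b p)⟫ := by
      have h := inner_add_two_mul_inner_of_isotropic hsymm hiso (b j) (b p) (b i)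
      rw [real_inner_comm, real_inner_comm (L (b j) (b p))]
      simp only [hb, if_neg hpj.symm] at h
      split_ifs at h ⊢ <;> linarith
    have hsum : ∑ i, (4 * ⟪L (b j) (b i), L (b j) (b p)⟫) • L (b j) (b i)
        = ((1 / 2) * μ₁ ^ 2) • L (b j) (b p) := by
      have hterm (i) : (4 * ⟪L (b j) (b i), L (b j) (b p)⟫) • L (b j) (b i) =
          (⟪L (b j) (b i), L (b j) (b p)⟫ • L (b j) (b i)
            + ⟪L (b j) (b i), L (b j) (b p)⟫ • L (b j) (b i)
            - ⟪L (b j) (b i), L (b j) (b j)⟫ • L (b p) (b i)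
            - ⟪L (b p) (b i), L (b j) (b j)⟫ • L (b j) (b i))
          + ((if j = i then (μ₁ ^ 2 / 4) • L (b p) (b i) else 0)
            + if p = i then (μ₁ ^ 2 / 4) • L (b j) (b i) else 0) := by
        rw [hj, hp]
        split_ifs <;> module
      simp only [hterm]
      rw [Finset.sum_add_distrib, h514 b (b j) (b j) (b j) (b p), Finset.sum_add_distrib,
        Finset.sum_ite_eq, Finset.sum_ite_eq, hsymm (b p) (b j)]
      simp only [Finset.mem_univ, if_true]
      module
    rw [Finset.filter_ne', sub_smul, ← hsum, ← Finset.add_sum_erase _ _ (Finset.mem_univ p)]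
    abel
  refine ⟨key, fun b j p hpj hne horth => ?_⟩
  have h := key b j p hpj
  rw [Finset.sum_eq_zero fun i hi => by rw [horth i (Finset.mem_filter.mp hi).2]; simp,
    sub_zero] at h
  have hcoeff := (smul_eq_zero.mp h.symm).resolve_right hne
  linarith
end

section
/- Let E and F be finite-dimensional real inner product spaces, let μ₁ > 0, set τ = μ₁²/8, and let L : E × E → F be a symmetric bilinear map that is isotropic with constant μ₁²/4 and satisfies identity (5.14). For a unit vector v ∈ E let P_v : E → E be the symmetric linear operator determined by ⟪P_v u, u'⟫ = ⟪L(v,u), L(v,u')⟫ for all u, u' ∈ E. Then: (a) P_v v = (μ₁²/4)·v; (b) P_v maps the orthogonal complement {v}^⊥ into itself; and (c) every eigenvalue of the restriction of P_v to {v}^⊥ equals 0 or τ. -/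
open scoped RealInnerProductSpace

section Isotropic

variable {E F : Type*} [NormedAddCommGroup E] [InnerProductSpace ℝ E]
  [NormedAddCommGroup F] [InnerProductSpace ℝ F]

/-- Partial polarization of the isotropy identity of a symmetric bilinear map. -/
theorem isotropic_bilinear_map_inner_self_self {k : ℝ} {L : E →ₗ[ℝ] E →ₗ[ℝ] F}
    (hsymm : ∀ v w : E, L v w = L w v)
    (hiso : ∀ v : E, ⟪L v v, L v v⟫ = k * ⟪v, v⟫ ^ 2) (v x : E) :
    ⟪L v v, L x x⟫ + 2 * ⟪L v x, L v x⟫ = k * (⟪v, v⟫ * ⟪x, x⟫ + 2 * ⟪v, x⟫ ^ 2) := by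
  have hadd := hiso (v + x)
  have hsub := hiso (v - x)
  have hv := hiso v
  have hx := hiso x
  simp only [map_add, map_sub, LinearMap.add_apply, LinearMap.sub_apply, inner_add_left,
    inner_add_right, inner_sub_left, inner_sub_right, hsymm x v, real_inner_comm v x,
    real_inner_comm (L v v) (L x x), real_inner_comm (L v v) (L v x),
    real_inner_comm (L v x) (L x x)] at hadd hsub
  linear_combination (hadd + hsub - 2 * hv - 2 * hx) / 4

/-- Polarization of the isotropy identity of a symmetric bilinear map in two of its arguments. -/
theorem isotropic_bilinear_map_inner_self {k : ℝ} {L : E →ₗ[ℝ] E →ₗ[ℝ] F}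
    (hsymm : ∀ v w : E, L v w = L w v)
    (hiso : ∀ v : E, ⟪L v v, L v v⟫ = k * ⟪v, v⟫ ^ 2) (v x y : E) :
    ⟪L v v, L x y⟫ + 2 * ⟪L v x, L v y⟫ =
      k * (⟪v, v⟫ * ⟪x, y⟫ + 2 * ⟪v, x⟫ * ⟪v, y⟫) := by
  have hadd := isotropic_bilinear_map_inner_self_self hsymm hiso v (x + y)
  have hx := isotropic_bilinear_map_inner_self_self hsymm hiso v x
  have hy := isotropic_bilinear_map_inner_self_self hsymm hiso v y
  simp only [map_add, LinearMap.add_apply, inner_add_left, inner_add_right, hsymm y x,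
    real_inner_comm x y, real_inner_comm (L v x) (L v y)] at hadd
  linear_combination (hadd - hx - hy) / 2

end Isotropic

/-- Expanding a vector in an orthonormal basis inside the argument of a linear map. -/
theorem OrthonormalBasis.sum_inner_smul_map {ι E F : Type*} [Fintype ι]
    [NormedAddCommGroup E] [InnerProductSpace ℝ E] [AddCommGroup F] [Module ℝ F]
    (b : OrthonormalBasis ι ℝ E) (f : E →ₗ[ℝ] F) (x : E) :
    ∑ i, ⟪x, b i⟫ • f (b i) = f x := by
  conv_rhs => rw [← b.sum_repr' x]
  simp only [map_sum, map_smul, real_inner_comm]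

/-- Lemma 5.7: for an isotropic symmetric bilinear map `L` satisfying (5.14),
and a unit vector `v`, the symmetric operator `P_v` with `⟪P_v u, u'⟫ = ⟪L(v,u), L(v,u')⟫`
satisfies: (a) `P_v v = (μ₁²/4)v`; (b) `P_v` preserves `{v}^⊥`; (c) every eigenvalue of
`P_v` on `{v}^⊥` is `0` or `τ = μ₁²/8`. -/
theorem isotropic_bilinear_map_Pv_eigenvalues
    {E F : Type*} [NormedAddCommGroup E] [InnerProductSpace ℝ E] [FiniteDimensional ℝ E]
    [NormedAddCommGroup F] [InnerProductSpace ℝ F] [FiniteDimensional ℝ F]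
    (μ₁ τ : ℝ) (hμ₁ : 0 < μ₁) (hτ : τ = μ₁ ^ 2 / 8)
    (L : E →ₗ[ℝ] E →ₗ[ℝ] F) (hsymm : ∀ v w : E, L v w = L w v)
    (hiso : ∀ v : E, ⟪L v v, L v v⟫ = (μ₁ ^ 2 / 4) * ⟪v, v⟫ ^ 2)
    (h514 : ∀ (b : OrthonormalBasis (Fin (Module.finrank ℝ E)) ℝ E) (v₁ v₂ v₃ v₄ : E),
      ∑ i, (⟪L v₁ (b i), L v₃ v₄⟫ • L v₂ (b i) + ⟪L v₂ (b i), L v₃ v₄⟫ • L v₁ (b i)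
        - ⟪L v₃ (b i), L v₁ v₂⟫ • L v₄ (b i) - ⟪L v₄ (b i), L v₁ v₂⟫ • L v₃ (b i)) = 0)
    (v : E) (hv : ‖v‖ = 1)
    (P : E →ₗ[ℝ] E) (hP : ∀ u u' : E, ⟪P u, u'⟫ = ⟪L v u, L v u'⟫) :
    P v = (μ₁ ^ 2 / 4) • v ∧
    (∀ u : E, ⟪u, v⟫ = 0 → ⟪P u, v⟫ = 0) ∧
    (∀ (c : ℝ) (u : E), u ≠ 0 → ⟪u, v⟫ = 0 → P u = c • u → c = 0 ∨ c = τ) := by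
  have hvv : ⟪v, v⟫ = 1 := by rw [real_inner_self_eq_norm_sq, hv, one_pow]
  have hcubic (x : E) : ⟪L v v, L v x⟫ = μ₁ ^ 2 / 4 * ⟪v, x⟫ := by
    have h := isotropic_bilinear_map_inner_self hsymm hiso v v x
    rw [hvv] at h
    linear_combination h / 3
  refine ⟨ext_inner_right ℝ fun x => ?_, fun u hu => ?_, fun c u hu huv hPu => ?_⟩
  · rw [hP, hcubic, real_inner_smul_left]
  · rw [hP, real_inner_comm, hcubic, real_inner_comm, hu, mul_zero]
  · have hPx (x : E) : ⟪L v u, L v x⟫ = c * ⟪u, x⟫ := by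
      rw [← hP, hPu, real_inner_smul_left]
    have hvux (x : E) : ⟪L v v, L u x⟫ = (μ₁ ^ 2 / 4 - 2 * c) * ⟪u, x⟫ := by
      have h := isotropic_bilinear_map_inner_self hsymm hiso v u x
      rw [hvv, hPx, real_inner_comm u v, huv] at h
      linear_combination h
    let b := stdOrthonormalBasis ℝ E
    have hL : (μ₁ ^ 2 / 2 - 4 * c) • L v u = 0 := by
      have h := h514 b v u v v
      simp only [real_inner_comm (L v v), real_inner_comm (L v u), hcubic, hvux, hPx, mul_smul,
        Finset.sum_sub_distrib, Finset.sum_add_distrib, ← Finset.smul_sum,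
        b.sum_inner_smul_map, hsymm u v] at h
      rw [← h]
      module
    rcases smul_eq_zero.mp hL with h | h
    · right
      linarith
    · left
      have hcu := hPx u
      rw [h, inner_zero_left] at hcu
      exact (mul_eq_zero.mp hcu.symm).resolve_right (inner_self_ne_zero.mpr hu)
end

section
/- Let E and F be real inner product spaces, μ₁ > 0, and L : E × E → F a symmetric bilinear map that is isotropic with constant μ₁²/4. Let v, u ∈ E be orthonormal vectors. Then the following are equivalent: (i) ⟪L(v,u), L(v,u')⟫ = 0 for all u' ∈ E (i.e., P_v u = 0); (ii) L(u,v) = 0; (iii) L(u,u) = L(v,v); (iv) ⟪L(u,v), L(u,v')⟫ = 0 for all v' ∈ E (i.e., P_u v = 0). Moreover, any of these conditions implies (v): ⟪L(v,w₁), L(v,w₂)⟫ = ⟪L(u,w₁), L(u,w₂)⟫ for all w₁, w₂ ∈ E orthogonal to both u and v. -/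
open scoped RealInnerProductSpace

section Polarization

variable {E F : Type*} [NormedAddCommGroup E] [InnerProductSpace ℝ E]
  [NormedAddCommGroup F] [InnerProductSpace ℝ F]

/-- Polarization of the isotropy identity in two variables. -/
theorem inner_diag_add_two_mul_of_isotropic {c : ℝ}
    (L : E →ₗ[ℝ] E →ₗ[ℝ] F) (hsymm : ∀ v w : E, L v w = L w v)
    (hiso : ∀ v : E, ⟪L v v, L v v⟫ = c * ⟪v, v⟫ ^ 2) (x y : E) :
    ⟪L x x, L y y⟫ + 2 * ⟪L x y, L x y⟫ = c * (⟪x, x⟫ * ⟪y, y⟫ + 2 * ⟪x, y⟫ ^ 2) := by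
  have hadd := hiso (x + y)
  have hsub := hiso (x - y)
  have hx := hiso x
  have hy := hiso y
  simp only [map_add, map_sub, LinearMap.add_apply, LinearMap.sub_apply, inner_add_left,
    inner_add_right, inner_sub_left, inner_sub_right, hsymm y x, real_inner_comm x y,
    real_inner_comm (L x x) (L y y), real_inner_comm (L x x) (L x y),
    real_inner_comm (L x y) (L y y)] at hadd hsub
  linear_combination (hadd + hsub) / 4 - hx / 2 - hy / 2

/-- Polarization of the isotropy identity in three variables. -/
theorem inner_diag_add_two_mul_inner_of_isotropic {c : ℝ}
    (L : E →ₗ[ℝ] E →ₗ[ℝ] F) (hsymm : ∀ v w : E, L v w = L w v)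
    (hiso : ∀ v : E, ⟪L v v, L v v⟫ = c * ⟪v, v⟫ ^ 2) (x y z : E) :
    ⟪L x x, L y z⟫ + 2 * ⟪L x y, L x z⟫ =
      c * (⟪x, x⟫ * ⟪y, z⟫ + 2 * (⟪x, y⟫ * ⟪x, z⟫)) := by
  have hadd := inner_diag_add_two_mul_of_isotropic L hsymm hiso x (y + z)
  have hy := inner_diag_add_two_mul_of_isotropic L hsymm hiso x y
  have hz := inner_diag_add_two_mul_of_isotropic L hsymm hiso x z
  simp only [map_add, LinearMap.add_apply, inner_add_left, inner_add_right, hsymm z y,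
    real_inner_comm y z, real_inner_comm (L x y) (L x z)] at hadd
  linear_combination (hadd - hy - hz) / 2

end Polarization

/-- Lemma 5.8: for an isotropic symmetric bilinear map `L` with constant `μ₁²/4`
and orthonormal `v, u`, the following are equivalent: (i) `P_v u = 0`, i.e.
`⟪L(v,u),L(v,u')⟫ = 0` for all `u'`; (ii) `L(u,v) = 0`; (iii) `L(u,u) = L(v,v)`;
(iv) `P_u v = 0`. Moreover each implies (v): `⟪L(v,w₁),L(v,w₂)⟫ = ⟪L(u,w₁),L(u,w₂)⟫` for all
`w₁,w₂` orthogonal to both `u` and `v`. -/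
theorem isotropic_bilinear_map_Vv0_equivalences
    {E F : Type*} [NormedAddCommGroup E] [InnerProductSpace ℝ E]
    [NormedAddCommGroup F] [InnerProductSpace ℝ F]
    (μ₁ : ℝ) (hμ₁ : 0 < μ₁)
    (L : E →ₗ[ℝ] E →ₗ[ℝ] F) (hsymm : ∀ v w : E, L v w = L w v)
    (hiso : ∀ v : E, ⟪L v v, L v v⟫ = (μ₁ ^ 2 / 4) * ⟪v, v⟫ ^ 2)
    (v u : E) (hv : ‖v‖ = 1) (hu : ‖u‖ = 1) (hvu : ⟪v, u⟫ = 0) :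
    ((∀ u' : E, ⟪L v u, L v u'⟫ = 0) ↔ L u v = 0) ∧
    (L u v = 0 ↔ L u u = L v v) ∧
    (L u u = L v v ↔ ∀ v' : E, ⟪L u v, L u v'⟫ = 0) ∧
    (L u v = 0 →
      ∀ w₁ w₂ : E, ⟪w₁, u⟫ = 0 → ⟪w₁, v⟫ = 0 → ⟪w₂, u⟫ = 0 → ⟪w₂, v⟫ = 0 →
        ⟪L v w₁, L v w₂⟫ = ⟪L u w₁, L u w₂⟫) := by
  have hpol := inner_diag_add_two_mul_inner_of_isotropic L hsymm hiso
  have hvv : ⟪v, v⟫ = 1 := by rw [real_inner_self_eq_norm_sq, hv, one_pow]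
  have huu : ⟪u, u⟫ = 1 := by rw [real_inner_self_eq_norm_sq, hu, one_pow]
  have huv : ⟪u, v⟫ = 0 := by rw [real_inner_comm, hvu]
  have hdist : ⟪L u u - L v v, L u u - L v v⟫ = 4 * ⟪L u v, L u v⟫ := by
    have h := hpol u v v
    have hu4 := hiso u
    have hv4 := hiso v
    rw [huu, hvv, huv] at h
    rw [huu] at hu4
    rw [hvv] at hv4
    simp only [inner_sub_left, inner_sub_right, real_inner_comm (L u u) (L v v)]
    linear_combination hu4 + hv4 - 2 * h
  have h23 : L u v = 0 ↔ L u u = L v v := by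
    rw [← sub_eq_zero (a := L u u), ← inner_self_eq_zero (𝕜 := ℝ) (x := L u u - L v v), hdist,
      mul_eq_zero_iff_left (by norm_num), inner_self_eq_zero]
  refine ⟨⟨fun h => ?_, fun h u' => ?_⟩, h23, ⟨fun h v' => ?_, fun h => ?_⟩, ?_⟩
  · rw [hsymm]
    exact inner_self_eq_zero.mp (h u)
  · rw [hsymm v u, h, inner_zero_left]
  · rw [h23.mpr h, inner_zero_left]
  · exact h23.mp (inner_self_eq_zero.mp (h v))
  · intro h w₁ w₂ h₁u h₁v _ _
    have hPv := hpol v w₁ w₂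
    have hPu := hpol u w₁ w₂
    rw [hvv, ← h23.mp h, real_inner_comm w₁ v, h₁v] at hPv
    rw [huu, real_inner_comm w₁ u, h₁u] at hPu
    linear_combination (hPv - hPu) / 2
end

section
/- Let E and F be finite-dimensional real inner product spaces, μ₁ > 0, τ = μ₁²/8, and L : E × E → F a symmetric bilinear map that is isotropic with constant μ₁²/4 and satisfies identity (5.14). Let v, ṽ ∈ E be orthonormal vectors. Then ⟪L(v,ṽ), L(v,ṽ)⟫ = τ holds if and only if P_v ṽ = τ·ṽ. Moreover, if u ∈ E is a unit vector with P_v u = 0 and ⟪L(v,ṽ), L(v,ṽ)⟫ = τ, then P_ṽ u = τ·u. -/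
open scoped RealInnerProductSpace

namespace IsotropicBilinear

variable {E F : Type*} [NormedAddCommGroup E] [InnerProductSpace ℝ E]
  [NormedAddCommGroup F] [InnerProductSpace ℝ F]

/-- Polarization of the isotropy condition in the directions `v, v, a, b`. -/
theorem inner_polarization {c : ℝ} {L : E →ₗ[ℝ] E →ₗ[ℝ] F} (hsymm : ∀ v w : E, L v w = L w v)
    (hiso : ∀ v : E, ⟪L v v, L v v⟫ = c * ⟪v, v⟫ ^ 2) (v a b : E) :
    ⟪L a b, L v v⟫ = c * (⟪v, v⟫ * ⟪a, b⟫ + 2 * ⟪v, a⟫ * ⟪v, b⟫) - 2 * ⟪L v a, L v b⟫ := by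
  have h1 := hiso (v + a + b)
  have h2 := hiso (v - a - b)
  have h3 := hiso (v + a - b)
  have h4 := hiso (v - a + b)
  have h5 := hiso (a + b)
  have h6 := hiso (a - b)
  simp only [map_add, map_sub, LinearMap.add_apply, LinearMap.sub_apply, inner_add_left,
    inner_add_right, inner_sub_left, inner_sub_right, hsymm a v, hsymm b v, hsymm b a,
    real_inner_comm v a, real_inner_comm v b, real_inner_comm a b,
    real_inner_comm (L v v) (L v a), real_inner_comm (L v v) (L v b),
    real_inner_comm (L v v) (L a a), real_inner_comm (L v v) (L a b),
    real_inner_comm (L v v) (L b b), real_inner_comm (L v a) (L v b),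
    real_inner_comm (L v a) (L a a), real_inner_comm (L v a) (L a b),
    real_inner_comm (L v a) (L b b), real_inner_comm (L v b) (L a a),
    real_inner_comm (L v b) (L a b), real_inner_comm (L v b) (L b b),
    real_inner_comm (L a a) (L a b), real_inner_comm (L a a) (L b b),
    real_inner_comm (L a b) (L b b)] at h1 h2 h3 h4 h5 h6 ⊢
  linear_combination (h1 + h2 - h3 - h4 - 2 * h5 + 2 * h6) / 16

/-- Contracting `L d` against the functional `y ↦ ⟪L a y, ξ⟫`, represented by `s`. -/
theorem sum_inner_smul {ι : Type*} [Fintype ι] (e : OrthonormalBasis ι ℝ E)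
    (L : E →ₗ[ℝ] E →ₗ[ℝ] F) {a s : E} {ξ : F} (hs : ∀ y, ⟪L a y, ξ⟫ = ⟪s, y⟫) (d : E) :
    ∑ i, ⟪L a (e i), ξ⟫ • L d (e i) = L d s := by
  conv_rhs => rw [← e.sum_repr' s]
  simp only [map_sum, map_smul, hs, real_inner_comm]

variable [FiniteDimensional ℝ E]

/-- `IsContractionSymmetric L` expresses the exchange identity satisfied by the contraction of
`L` with itself over an orthonormal basis. -/
def IsContractionSymmetric (L : E →ₗ[ℝ] E →ₗ[ℝ] F) : Prop :=
  ∀ (b : OrthonormalBasis (Fin (Module.finrank ℝ E)) ℝ E) (v₁ v₂ v₃ v₄ : E),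
    ∑ i, (⟪L v₁ (b i), L v₃ v₄⟫ • L v₂ (b i) + ⟪L v₂ (b i), L v₃ v₄⟫ • L v₁ (b i)
      - ⟪L v₃ (b i), L v₁ v₂⟫ • L v₄ (b i) - ⟪L v₄ (b i), L v₁ v₂⟫ • L v₃ (b i)) = 0

theorem IsContractionSymmetric.apply_eq {L : E →ₗ[ℝ] E →ₗ[ℝ] F} (h : IsContractionSymmetric L)
    {v₁ v₂ v₃ v₄ s₁ s₂ s₃ s₄ : E}
    (h₁ : ∀ y, ⟪L v₁ y, L v₃ v₄⟫ = ⟪s₁, y⟫) (h₂ : ∀ y, ⟪L v₂ y, L v₃ v₄⟫ = ⟪s₂, y⟫)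
    (h₃ : ∀ y, ⟪L v₃ y, L v₁ v₂⟫ = ⟪s₃, y⟫) (h₄ : ∀ y, ⟪L v₄ y, L v₁ v₂⟫ = ⟪s₄, y⟫) :
    L v₂ s₁ + L v₁ s₂ = L v₄ s₃ + L v₃ s₄ := by
  have := h (stdOrthonormalBasis ℝ E) v₁ v₂ v₃ v₄
  simp only [Finset.sum_sub_distrib, Finset.sum_add_distrib, sum_inner_smul _ L h₁,
    sum_inner_smul _ L h₂, sum_inner_smul _ L h₃, sum_inner_smul _ L h₄] at this
  rw [← sub_eq_zero, ← this]
  abel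

variable {τ : ℝ} {L : E →ₗ[ℝ] E →ₗ[ℝ] F}

theorem apply_operator_eq_smul (hsymm : ∀ v w : E, L v w = L w v)
    (hiso : ∀ v : E, ⟪L v v, L v v⟫ = 2 * τ * ⟪v, v⟫ ^ 2) (hL : IsContractionSymmetric L)
    {v x : E} (hv : ‖v‖ = 1) (hvx : ⟪v, x⟫ = 0)
    {P : E →ₗ[ℝ] E} (hP : ∀ a b : E, ⟪P a, b⟫ = ⟪L v a, L v b⟫) :
    L v (P x) = τ • L v x := by
  have hvv : ⟪v, v⟫ = 1 := by rw [real_inner_self_eq_norm_sq, hv, one_pow]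
  have key := hL.apply_eq (v₁ := v) (v₂ := v) (v₃ := v) (v₄ := x) (s₁ := P x) (s₂ := P x)
    (s₃ := (2 * τ) • v) (s₄ := (2 * τ) • x - (2 : ℝ) • P x)
    (fun y => by rw [hP, real_inner_comm]) (fun y => by rw [hP, real_inner_comm])
    (fun y => by
      have := inner_polarization hsymm hiso v v y
      rw [hvv, real_inner_comm] at this
      rw [real_inner_comm, real_inner_smul_left]
      linarith)
    (fun y => by
      rw [inner_polarization hsymm hiso v x y, hvv, hvx, inner_sub_left, real_inner_smul_left,
        real_inner_smul_left, hP]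
      ring)
  rw [map_sub, map_smul, map_smul, map_smul, hsymm x v] at key
  linear_combination (norm := module) (1 / 4 : ℝ) • key

/-- A unit vector `w` orthogonal to `v` with `⟪P_v w, w⟫ = τ` is an eigenvector of `P_v`. -/
theorem operator_eq_smul (hsymm : ∀ v w : E, L v w = L w v)
    (hiso : ∀ v : E, ⟪L v v, L v v⟫ = 2 * τ * ⟪v, v⟫ ^ 2) (hL : IsContractionSymmetric L)
    {v w : E} (hv : ‖v‖ = 1) (hw : ‖w‖ = 1) (hvw : ⟪v, w⟫ = 0)
    {P : E →ₗ[ℝ] E} (hP : ∀ a b : E, ⟪P a, b⟫ = ⟪L v a, L v b⟫)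
    (h : ⟪L v w, L v w⟫ = τ) : P w = τ • w := by
  have hww : ⟪w, w⟫ = 1 := by rw [real_inner_self_eq_norm_sq, hw, one_pow]
  rw [← sub_eq_zero, ← inner_self_eq_zero (𝕜 := ℝ)]
  simp only [inner_sub_left, inner_sub_right, real_inner_smul_left, real_inner_smul_right,
    real_inner_comm (P w) w, hP, map_smul, apply_operator_eq_smul hsymm hiso hL hv hvw hP, h, hww]
  ring

/-- If `L v u = 0` for orthonormal `v, u`, then `L u u = L v v`. -/
theorem apply_self_eq_of_apply_eq_zero (hτ : τ ≠ 0) (hsymm : ∀ v w : E, L v w = L w v)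
    (hiso : ∀ v : E, ⟪L v v, L v v⟫ = 2 * τ * ⟪v, v⟫ ^ 2) (hL : IsContractionSymmetric L)
    {v u : E} (hv : ‖v‖ = 1) (hu : ‖u‖ = 1) (hvu : ⟪v, u⟫ = 0) (h : L v u = 0) :
    L u u = L v v := by
  have hvv : ⟪v, v⟫ = 1 := by rw [real_inner_self_eq_norm_sq, hv, one_pow]
  have huu : ⟪u, u⟫ = 1 := by rw [real_inner_self_eq_norm_sq, hu, one_pow]
  have huv : ⟪u, v⟫ = 0 := by rw [real_inner_comm, hvu]
  have h1 : ∀ y, ⟪L u y, L v v⟫ = ⟪(2 * τ) • u, y⟫ := fun y => by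
    rw [inner_polarization hsymm hiso v u y, hvv, hvu, h, inner_zero_left, real_inner_smul_left]
    ring
  have h2 : ∀ y, ⟪L v y, L u u⟫ = ⟪(2 * τ) • v, y⟫ := fun y => by
    rw [inner_polarization hsymm hiso u v y, huu, huv, hsymm u v, h, inner_zero_left,
      real_inner_smul_left]
    ring
  have key := hL.apply_eq h1 h1 h2 h2
  rw [map_smul, map_smul, ← two_smul ℝ, ← two_smul ℝ, smul_smul, smul_smul] at key
  exact smul_right_injective F (by simpa using hτ : (2 : ℝ) * (2 * τ) ≠ 0) key

end IsotropicBilinear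

open IsotropicBilinear in
/-- Lemma 5.9: with `τ = μ₁²/8` and `P_v`, `P_w` the operators associated to an
isotropic symmetric bilinear map `L` satisfying (5.14), for orthonormal `v, w` one has
`⟪L(v,w),L(v,w)⟫ = τ` iff `P_v w = τ·w`; moreover if `u` is a unit vector with `P_v u = 0`
and `⟪L(v,w),L(v,w)⟫ = τ`, then `P_w u = τ·u`. -/
theorem isotropic_bilinear_map_Vvtau_characterization
    {E F : Type*} [NormedAddCommGroup E] [InnerProductSpace ℝ E] [FiniteDimensional ℝ E]
    [NormedAddCommGroup F] [InnerProductSpace ℝ F] [FiniteDimensional ℝ F]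
    (μ₁ τ : ℝ) (hμ₁ : 0 < μ₁) (hτ : τ = μ₁ ^ 2 / 8)
    (L : E →ₗ[ℝ] E →ₗ[ℝ] F) (hsymm : ∀ v w : E, L v w = L w v)
    (hiso : ∀ v : E, ⟪L v v, L v v⟫ = (μ₁ ^ 2 / 4) * ⟪v, v⟫ ^ 2)
    (h514 : ∀ (b : OrthonormalBasis (Fin (Module.finrank ℝ E)) ℝ E) (v₁ v₂ v₃ v₄ : E),
      ∑ i, (⟪L v₁ (b i), L v₃ v₄⟫ • L v₂ (b i) + ⟪L v₂ (b i), L v₃ v₄⟫ • L v₁ (b i)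
        - ⟪L v₃ (b i), L v₁ v₂⟫ • L v₄ (b i) - ⟪L v₄ (b i), L v₁ v₂⟫ • L v₃ (b i)) = 0)
    (v w : E) (hv : ‖v‖ = 1) (hw : ‖w‖ = 1) (hvw : ⟪v, w⟫ = 0)
    (Pv : E →ₗ[ℝ] E) (hPv : ∀ a b : E, ⟪Pv a, b⟫ = ⟪L v a, L v b⟫)
    (Pw : E →ₗ[ℝ] E) (hPw : ∀ a b : E, ⟪Pw a, b⟫ = ⟪L w a, L w b⟫) :
    (⟪L v w, L v w⟫ = τ ↔ Pv w = τ • w) ∧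
    (∀ u : E, ‖u‖ = 1 → Pv u = 0 → ⟪L v w, L v w⟫ = τ → Pw u = τ • u) := by
  have hτ0 : τ ≠ 0 := by rw [hτ]; positivity
  have hiso' : ∀ v : E, ⟪L v v, L v v⟫ = 2 * τ * ⟪v, v⟫ ^ 2 := fun v => by
    rw [hiso, hτ]; ring
  have hvv : ⟪v, v⟫ = 1 := by rw [real_inner_self_eq_norm_sq, hv, one_pow]
  have hww : ⟪w, w⟫ = 1 := by rw [real_inner_self_eq_norm_sq, hw, one_pow]
  refine ⟨⟨operator_eq_smul hsymm hiso' h514 hv hw hvw hPv, fun h => ?_⟩, fun u hu hPu h => ?_⟩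
  · rw [← hPv, h, real_inner_smul_left, hww, mul_one]
  have huu : ⟪u, u⟫ = 1 := by rw [real_inner_self_eq_norm_sq, hu, one_pow]
  have hLvu : L v u = 0 := by
    rw [← inner_self_eq_zero (𝕜 := ℝ), ← hPv, hPu, inner_zero_left]
  have hvu : ⟪v, u⟫ = 0 := by
    have := inner_polarization hsymm hiso' v v u
    rw [hLvu, inner_zero_left, inner_zero_right, hvv] at this
    exact (mul_eq_zero.mp (by linarith : τ * ⟪v, u⟫ = 0)).resolve_left hτ0
  have hwu : ⟪w, u⟫ = 0 := by
    have := hPv w u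
    rw [operator_eq_smul hsymm hiso' h514 hv hw hvw hPv h, hLvu, inner_zero_right,
      real_inner_smul_left] at this
    exact (mul_eq_zero.mp this).resolve_left hτ0
  refine operator_eq_smul hsymm hiso' h514 hw hu hwu hPw ?_
  have h1 := inner_polarization hsymm hiso' v w w
  have h2 := inner_polarization hsymm hiso' w u u
  rw [hvv, hww, hvw, h] at h1
  rw [huu, hww, hwu, apply_self_eq_of_apply_eq_zero hτ0 hsymm hiso' h514 hv hu hvu hLvu,
    real_inner_comm] at h2
  linarith
end

section
/- Let E and F be finite-dimensional real inner product spaces, μ₁ > 0, τ = μ₁²/8, and L : E × E → F a symmetric bilinear map that is isotropic with constant μ₁²/4 and satisfies identity (5.14). Let v₁, v₂, v₃ ∈ E be orthonormal vectors satisfying P_{v₃} v₁ = τ·v₁ and P_{v₃} v₂ = τ·v₂. Then for every vector v ∈ E, ⟪L(v₁,v₂), L(v,v₃)⟫ = 0. -/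
open scoped RealInnerProductSpace

section IsotropicBilinearMap

variable {E F : Type*} [NormedAddCommGroup E] [InnerProductSpace ℝ E]
  [NormedAddCommGroup F] [InnerProductSpace ℝ F]

/-- Polarization of the isotropy condition in two variables. -/
lemma isotropic_polarization_two {c : ℝ} {L : E →ₗ[ℝ] E →ₗ[ℝ] F}
    (hsymm : ∀ v w : E, L v w = L w v) (hiso : ∀ v : E, ⟪L v v, L v v⟫ = c * ⟪v, v⟫ ^ 2)
    (x y : E) :
    ⟪L x x, L y y⟫ + 2 * ⟪L x y, L x y⟫ = c * (⟪x, x⟫ * ⟪y, y⟫ + 2 * ⟪x, y⟫ ^ 2) := by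
  have hadd := hiso (x + y)
  have hsub := hiso (x - y)
  have hx := hiso x
  have hy := hiso y
  simp only [map_add, map_sub, LinearMap.add_apply, LinearMap.sub_apply, inner_add_left,
    inner_add_right, inner_sub_left, inner_sub_right, hsymm y x, real_inner_comm x y,
    real_inner_comm (L x x) (L y y), real_inner_comm (L x x) (L x y),
    real_inner_comm (L x y) (L y y)] at hadd hsub
  linear_combination (hadd + hsub - 2 * hx - 2 * hy) / 4

/-- Polarization of the isotropy condition in three variables. -/
lemma isotropic_polarization_three {c : ℝ} {L : E →ₗ[ℝ] E →ₗ[ℝ] F}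
    (hsymm : ∀ v w : E, L v w = L w v) (hiso : ∀ v : E, ⟪L v v, L v v⟫ = c * ⟪v, v⟫ ^ 2)
    (x y z : E) :
    ⟪L x x, L y z⟫ + 2 * ⟪L x y, L x z⟫ = c * (⟪x, x⟫ * ⟪y, z⟫ + 2 * (⟪x, y⟫ * ⟪x, z⟫)) := by
  have hadd := isotropic_polarization_two hsymm hiso x (y + z)
  have hy := isotropic_polarization_two hsymm hiso x y
  have hz := isotropic_polarization_two hsymm hiso x z
  simp only [map_add, LinearMap.add_apply, inner_add_left, inner_add_right, hsymm z y,
    real_inner_comm y z, real_inner_comm (L x y) (L x z)] at hadd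
  linear_combination (hadd - hy - hz) / 2

end IsotropicBilinearMap

/-- Lemma 5.10: for an isotropic symmetric bilinear map `L` satisfying (5.14),
if `v₁, v₂, v₃` are orthonormal with `P_{v₃} v₁ = τ·v₁` and `P_{v₃} v₂ = τ·v₂` (`τ = μ₁²/8`),
then `⟪L(v₁,v₂), L(v,v₃)⟫ = 0` for every `v ∈ E`. -/
theorem isotropic_bilinear_map_orthogonality_lemma
    {E F : Type*} [NormedAddCommGroup E] [InnerProductSpace ℝ E] [FiniteDimensional ℝ E]
    [NormedAddCommGroup F] [InnerProductSpace ℝ F] [FiniteDimensional ℝ F]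
    (μ₁ τ : ℝ) (hμ₁ : 0 < μ₁) (hτ : τ = μ₁ ^ 2 / 8)
    (L : E →ₗ[ℝ] E →ₗ[ℝ] F) (hsymm : ∀ v w : E, L v w = L w v)
    (hiso : ∀ v : E, ⟪L v v, L v v⟫ = (μ₁ ^ 2 / 4) * ⟪v, v⟫ ^ 2)
    (h514 : ∀ (b : OrthonormalBasis (Fin (Module.finrank ℝ E)) ℝ E) (v₁ v₂ v₃ v₄ : E),
      ∑ i, (⟪L v₁ (b i), L v₃ v₄⟫ • L v₂ (b i) + ⟪L v₂ (b i), L v₃ v₄⟫ • L v₁ (b i)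
        - ⟪L v₃ (b i), L v₁ v₂⟫ • L v₄ (b i) - ⟪L v₄ (b i), L v₁ v₂⟫ • L v₃ (b i)) = 0)
    (v₁ v₂ v₃ : E) (horth : Orthonormal ℝ ![v₁, v₂, v₃])
    (P₃ : E →ₗ[ℝ] E) (hP₃ : ∀ a b : E, ⟪P₃ a, b⟫ = ⟪L v₃ a, L v₃ b⟫)
    (hv₁ : P₃ v₁ = τ • v₁) (hv₂ : P₃ v₂ = τ • v₂) :
    ∀ v : E, ⟪L v₁ v₂, L v v₃⟫ = 0 := by
  have h12 : ∀ u w : E, P₃ u = τ • u → ⟪v₃, u⟫ = 0 → ⟪L u w, L v₃ v₃⟫ = 0 := by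
    intro u w hu hort
    have hpol := isotropic_polarization_three hsymm hiso v₃ u w
    have h33 : ⟪v₃, v₃⟫ = 1 := by
      have := horth.1 2
      simp at this
      simp [this]
    rw [← hP₃, hu, real_inner_smul_left, h33, hort, hτ] at hpol
    rw [real_inner_comm]
    linear_combination hpol
  have h31 : ⟪v₃, v₁⟫ = 0 := horth.2 (i := 2) (j := 0) (by decide)
  have h32 : ⟪v₃, v₂⟫ = 0 := horth.2 (i := 2) (j := 1) (by decide)
  set b := stdOrthonormalBasis ℝ E
  have hsum : ∑ i, ⟪L v₃ (b i), L v₁ v₂⟫ ^ 2 = 0 := by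
    have h := congrArg (fun x => ⟪x, L v₁ v₂⟫) (h514 b v₁ v₂ v₃ v₃)
    simp only [h12 v₁ _ hv₁ h31, h12 v₂ _ hv₂ h32, sum_inner, inner_sub_left, inner_add_left,
      real_inner_smul_left, inner_zero_left] at h
    have h' : ∑ i, (-2) * ⟪L v₃ (b i), L v₁ v₂⟫ ^ 2 = 0 := by
      rw [← h]
      exact Finset.sum_congr rfl fun i _ => by ring
    rw [← Finset.mul_sum] at h'
    linarith
  have hbasis : ∀ i, ⟪L v₃ (b i), L v₁ v₂⟫ = 0 := fun i =>
    pow_eq_zero_iff two_ne_zero |>.1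
      ((Finset.sum_eq_zero_iff_of_nonneg fun i _ => sq_nonneg _).1 hsum i (Finset.mem_univ i))
  intro v
  rw [hsymm v v₃, real_inner_comm, ← b.sum_repr v]
  simp [sum_inner, real_inner_smul_left, hbasis]
end

section
/- Let E and F be finite-dimensional real inner product spaces with dim E ≥ 1, μ₁ > 0, τ = μ₁²/8, and L : E × E → F a symmetric bilinear map that is isotropic with constant μ₁²/4 and satisfies identity (5.14). Then there exist an integer k₀ ≥ 1 and unit vectors v₁, …, v_{k₀} ∈ E such that E is the internal orthogonal direct sum of the subspaces span{v_i} ⊕ V_{v_i}(0) for i = 1, …, k₀, and moreover P_{v_i} v_j = τ·v_j for all i ≠ j. -/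
open scoped RealInnerProductSpace

section IsotropicBilinearMap

variable {E F : Type*} [NormedAddCommGroup E] [InnerProductSpace ℝ E]
  [NormedAddCommGroup F] [InnerProductSpace ℝ F]

/-- The subspace `span{v} ⊕ V_v(0)`. -/
noncomputable def nullSpan (L : E →ₗ[ℝ] E →ₗ[ℝ] F) (v : E) : Submodule ℝ E :=
  (ℝ ∙ v) ⊔ ((ℝ ∙ v)ᗮ ⊓ LinearMap.ker (L v))

/-- `L` is symmetric and `‖L(v,v)‖² = c‖v‖⁴`. -/
structure IsIsotropicSymm (L : E →ₗ[ℝ] E →ₗ[ℝ] F) (c : ℝ) : Prop where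
  symm : ∀ v w, L v w = L w v
  inner_self : ∀ v, ⟪L v v, L v v⟫ = c * ⟪v, v⟫ ^ 2

lemma self_mem_nullSpan (L : E →ₗ[ℝ] E →ₗ[ℝ] F) (v : E) : v ∈ nullSpan L v :=
  Submodule.mem_sup_left (Submodule.mem_span_singleton_self v)

namespace IsIsotropicSymm

variable {L : E →ₗ[ℝ] E →ₗ[ℝ] F} {c : ℝ}

lemma inner_add_two_mul_inner_self (hL : IsIsotropicSymm L c) (a b : E) :
    ⟪L a a, L b b⟫ + 2 * ⟪L a b, L a b⟫ = c * (⟪a, a⟫ * ⟪b, b⟫ + 2 * ⟪a, b⟫ ^ 2) := by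
  have h1 := hL.inner_self (a + b)
  have h2 := hL.inner_self (a - b)
  have ha := hL.inner_self a
  have hb := hL.inner_self b
  simp only [map_add, map_sub, LinearMap.add_apply, LinearMap.sub_apply, inner_add_left,
    inner_add_right, inner_sub_left, inner_sub_right, hL.symm b a, real_inner_comm a b,
    real_inner_comm (L a a) (L a b), real_inner_comm (L b b) (L a b),
    real_inner_comm (L a a) (L b b)] at h1 h2 ⊢
  linear_combination (h1 + h2) / 4 - (ha + hb) / 2

lemma inner_add_two_mul_inner (hL : IsIsotropicSymm L c) (a b d : E) :
    ⟪L a a, L b d⟫ + 2 * ⟪L a b, L a d⟫ = c * (⟪a, a⟫ * ⟪b, d⟫ + 2 * ⟪a, b⟫ * ⟪a, d⟫) := by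
  have h := hL.inner_add_two_mul_inner_self a (b + d)
  have hb := hL.inner_add_two_mul_inner_self a b
  have hd := hL.inner_add_two_mul_inner_self a d
  simp only [map_add, LinearMap.add_apply, inner_add_left, inner_add_right, hL.symm d b,
    real_inner_comm b d, real_inner_comm (L a b) (L a d)] at h
  linear_combination (h - hb - hd) / 2

lemma inner_apply_self (hL : IsIsotropicSymm L c) (a d : E) :
    ⟪L a a, L a d⟫ = c * (⟪a, a⟫ * ⟪a, d⟫) := by
  linear_combination hL.inner_add_two_mul_inner a a d / 3

lemma apply_self_of_mem_nullSpan (hL : IsIsotropicSymm L c) {v x : E} (hv : ‖v‖ = 1)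
    (hx : x ∈ nullSpan L v) : L x x = ⟪x, x⟫ • L v v := by
  obtain ⟨y, hy, z, hz, rfl⟩ := Submodule.mem_sup.1 hx
  obtain ⟨s, rfl⟩ := Submodule.mem_span_singleton.1 hy
  have hvz : ⟪v, z⟫ = 0 := Submodule.mem_orthogonal_singleton_iff_inner_right.1 hz.1
  have hLz : L v z = 0 := hz.2
  have hvv : ⟪v, v⟫ = 1 := by rw [real_inner_self_eq_norm_sq, hv, one_pow]
  have hzz : L z z = ⟪z, z⟫ • L v v := by
    have h := hL.inner_add_two_mul_inner_self v z
    rw [hLz, hvz, hvv, inner_zero_left] at h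
    have h2 := hL.inner_self v
    rw [hvv] at h2
    rw [← sub_eq_zero, ← inner_self_eq_zero (𝕜 := ℝ)]
    simp only [inner_sub_left, inner_sub_right, real_inner_smul_left, real_inner_smul_right,
      real_inner_comm (L v v) (L z z), hL.inner_self z, h2]
    linear_combination (-2 * ⟪z, z⟫) * h
  have hzv : ⟪z, v⟫ = 0 := by rw [real_inner_comm, hvz]
  simp only [map_add, map_smul, LinearMap.add_apply, LinearMap.smul_apply, hL.symm z v, hLz, hzz,
    inner_add_left, inner_add_right, real_inner_smul_left, real_inner_smul_right, hvz, hvv, hzv]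
  module

lemma sum_inner_smul_apply {ι : Type*} [Fintype ι] (b : OrthonormalBasis ι ℝ E)
    (A B : E →ₗ[ℝ] F) (f : F) (x : E) (h : ∀ w, ⟪w, x⟫ = ⟪A w, f⟫) :
    ∑ i, ⟪A (b i), f⟫ • B (b i) = B x := by
  conv_rhs => rw [← b.sum_repr' x]
  simp [h]

variable [FiniteDimensional ℝ E] [FiniteDimensional ℝ F]

/-- The restriction of `P_v` to `v⊥` satisfies `L(v, P_v u) = (c/2) L(v, u)`. -/
lemma apply_adjoint_apply (hL : IsIsotropicSymm L c) {ι : Type*} [Fintype ι]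
    (b : OrthonormalBasis ι ℝ E)
    (hsum : ∀ v₁ v₂ v₃ v₄ : E,
      ∑ i, (⟪L v₁ (b i), L v₃ v₄⟫ • L v₂ (b i) + ⟪L v₂ (b i), L v₃ v₄⟫ • L v₁ (b i)
        - ⟪L v₃ (b i), L v₁ v₂⟫ • L v₄ (b i) - ⟪L v₄ (b i), L v₁ v₂⟫ • L v₃ (b i)) = 0)
    {v u : E} (hv : ‖v‖ = 1) (hvu : ⟪v, u⟫ = 0) :
    L v ((L v).adjoint (L v u)) = (c / 2) • L v u := by
  have hvv : ⟪v, v⟫ = 1 := by rw [real_inner_self_eq_norm_sq, hv, one_pow]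
  have h := hsum v v v u
  rw [Finset.sum_sub_distrib, Finset.sum_sub_distrib, Finset.sum_add_distrib,
    sum_inner_smul_apply b (L v) (L v) (L v u) _ fun w => LinearMap.adjoint_inner_right _ w _,
    sum_inner_smul_apply b (L v) (L u) (L v v) (c • v) fun w => by
      rw [real_inner_comm (L v v), hL.inner_apply_self, hvv, real_inner_smul_right,
        real_inner_comm v w, one_mul],
    sum_inner_smul_apply b (L u) (L v) (L v v) (c • u - (2 : ℝ) • (L v).adjoint (L v u))
      fun w => by
        have h1 := hL.inner_add_two_mul_inner v u w
        rw [hvu, hvv] at h1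
        rw [inner_sub_right, real_inner_smul_right, real_inner_smul_right,
          LinearMap.adjoint_inner_right, real_inner_comm (L v v), real_inner_comm (L v u),
          real_inner_comm u w]
        linear_combination -h1] at h
  simp only [map_sub, map_smul, hL.symm u v] at h
  have h4 : (4 : ℝ) • (L v ((L v).adjoint (L v u)) - (c / 2) • L v u) = 0 := by
    rw [← h]; module
  exact sub_eq_zero.1 ((smul_eq_zero.1 h4).resolve_left (by norm_num))

lemma adjoint_apply_of_mem_orthogonal
    (hP : ∀ v u : E, ‖v‖ = 1 → ⟪v, u⟫ = 0 → L v ((L v).adjoint (L v u)) = (c / 2) • L v u)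
    (hL : IsIsotropicSymm L c) {v w : E} (hv : ‖v‖ = 1) (hw : w ∈ (nullSpan L v)ᗮ) :
    (L v).adjoint (L v w) = (c / 2) • w := by
  have hvw : ⟪v, w⟫ = 0 := hw v (self_mem_nullSpan L v)
  set z := (L v).adjoint (L v w) - (c / 2) • w with hz
  have hLz : L v z = 0 := by rw [hz, map_sub, map_smul, hP v w hv hvw, sub_self]
  have hvz : ⟪v, z⟫ = 0 := by
    rw [hz, inner_sub_right, LinearMap.adjoint_inner_right, hL.inner_apply_self,
      real_inner_smul_right, hvw]
    ring
  have hzw : ⟪z, w⟫ = 0 := hw z (Submodule.mem_sup_right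
    ⟨Submodule.mem_orthogonal_singleton_iff_inner_right.2 hvz, hLz⟩)
  have hzz : ⟪z, z⟫ = 0 := by
    conv_lhs => rw [hz]
    rw [← hz, inner_sub_left, LinearMap.adjoint_inner_left, hLz, inner_zero_right,
      real_inner_smul_left, real_inner_comm, hzw]
    ring
  exact sub_eq_zero.1 (inner_self_eq_zero.1 hzz)

lemma inner_apply_le
    (hP : ∀ v u : E, ‖v‖ = 1 → ⟪v, u⟫ = 0 → L v ((L v).adjoint (L v u)) = (c / 2) • L v u)
    (hc : 0 < c) {v u : E} (hv : ‖v‖ = 1) (hvu : ⟪v, u⟫ = 0) :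
    ⟪L v u, L v u⟫ ≤ c / 2 * ⟪u, u⟫ := by
  have h : 0 ≤ ⟪(L v).adjoint (L v u) - (c / 2) • u, (L v).adjoint (L v u) - (c / 2) • u⟫ :=
    real_inner_self_nonneg
  rw [inner_sub_left, inner_sub_right, inner_sub_right, real_inner_smul_left,
    real_inner_smul_right, real_inner_smul_left, real_inner_smul_right,
    LinearMap.adjoint_inner_left, hP v u hv hvu, real_inner_smul_right,
    LinearMap.adjoint_inner_left, LinearMap.adjoint_inner_right] at h
  nlinarith

lemma inner_eq_zero_of_inner_apply_self_eq_zero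
    (hP : ∀ v u : E, ‖v‖ = 1 → ⟪v, u⟫ = 0 → L v ((L v).adjoint (L v u)) = (c / 2) • L v u)
    (hL : IsIsotropicSymm L c) (hc : 0 < c) {v b : E} (hv : ‖v‖ = 1)
    (h : ⟪L v v, L b b⟫ = 0) : ⟪v, b⟫ = 0 := by
  have hvv : ⟪v, v⟫ = 1 := by rw [real_inner_self_eq_norm_sq, hv, one_pow]
  have h1 := hL.inner_add_two_mul_inner_self v b
  have h2 := hL.inner_apply_self v b
  have h3 := hL.inner_self v
  have h4 := inner_apply_le hP hc (u := b - ⟪v, b⟫ • v) hv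
    (by rw [inner_sub_right, real_inner_smul_right, hvv]; ring)
  simp only [map_sub, map_smul, inner_sub_left, inner_sub_right, real_inner_smul_left,
    real_inner_smul_right, real_inner_comm (L v v) (L v b), real_inner_comm v b, hvv, h2, h3] at h4
  rw [h, hvv] at h1
  have h5 : c * ⟪v, b⟫ ^ 2 ≤ 0 := by nlinarith
  have h6 : ⟪v, b⟫ ^ 2 ≤ 0 := by nlinarith
  exact pow_eq_zero_iff two_ne_zero |>.1 (le_antisymm h6 (sq_nonneg _))

lemma nullSpan_isOrtho
    (hP : ∀ v u : E, ‖v‖ = 1 → ⟪v, u⟫ = 0 → L v ((L v).adjoint (L v u)) = (c / 2) • L v u)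
    (hL : IsIsotropicSymm L c) (hc : 0 < c) {v w : E} (hv : ‖v‖ = 1) (hw : ‖w‖ = 1)
    (hvw : w ∈ (nullSpan L v)ᗮ) : nullSpan L v ⟂ nullSpan L w := by
  have h0 : ⟪L v v, L w w⟫ = 0 := by
    have h := hL.inner_add_two_mul_inner_self v w
    rw [← LinearMap.adjoint_inner_left (L v) w (L v w),
      hL.adjoint_apply_of_mem_orthogonal hP hv hvw,
      hvw v (self_mem_nullSpan L v), real_inner_smul_left, real_inner_self_eq_norm_sq v, hv] at h
    linear_combination h
  rw [Submodule.isOrtho_iff_inner_eq]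
  intro a ha b hb
  rcases eq_or_ne a 0 with rfl | ha0
  · exact inner_zero_left b
  have ha1 : ‖a‖⁻¹ ≠ 0 := inv_ne_zero (norm_ne_zero_iff.2 ha0)
  have h := inner_eq_zero_of_inner_apply_self_eq_zero hP hL hc (v := ‖a‖⁻¹ • a) (b := b)
    (norm_smul_inv_norm (𝕜 := ℝ) ha0) (by
      simp only [map_smul, LinearMap.smul_apply, hL.apply_self_of_mem_nullSpan hv ha,
        hL.apply_self_of_mem_nullSpan hw hb, real_inner_smul_left, real_inner_smul_right, h0,
        mul_zero])
  rw [real_inner_smul_left] at h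
  exact (mul_eq_zero.1 h).resolve_left ha1

end IsIsotropicSymm

/-- If `v ∈ U v` and `U w ⟂ U v` for unit vectors `w ⟂ U v`, then the whole space is an orthogonal
sum of subspaces `U (v i)`. -/
lemma exists_orthogonal_family_iSup_eq_top [FiniteDimensional ℝ E] (U : E → Submodule ℝ E)
    (hself : ∀ v, v ∈ U v)
    (hU : ∀ v w, ‖v‖ = 1 → ‖w‖ = 1 → w ∈ (U v)ᗮ → U v ⟂ U w) :
    ∃ (k : ℕ) (v : Fin k → E), (∀ i, ‖v i‖ = 1) ∧ (∀ i j, i ≠ j → U (v i) ⟂ U (v j)) ∧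
      ⨆ i, U (v i) = ⊤ := by
  by_contra! hcon
  have hex : ∀ k : ℕ, ∃ v : Fin k → E, (∀ i, ‖v i‖ = 1) ∧ ∀ i j, i ≠ j → U (v i) ⟂ U (v j) := by
    intro k
    induction k with
    | zero => exact ⟨Fin.elim0, fun i => i.elim0, fun i => i.elim0⟩
    | succ k ih =>
      obtain ⟨v, hv, hvU⟩ := ih
      have hne : (⨆ i, U (v i))ᗮ ≠ ⊥ := fun h =>
        hcon k v hv hvU (Submodule.orthogonal_eq_bot_iff.1 h)
      obtain ⟨x, hx, hx0⟩ := Submodule.exists_mem_ne_zero_of_ne_bot hne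
      have hw : ‖‖x‖⁻¹ • x‖ = 1 := norm_smul_inv_norm (𝕜 := ℝ) hx0
      have hwU : ∀ i, U (v i) ⟂ U (‖x‖⁻¹ • x) := fun i => hU _ _ (hv i) hw
        (Submodule.orthogonal_le (le_iSup (fun i => U (v i)) i) (Submodule.smul_mem _ _ hx))
      refine ⟨Fin.cons (‖x‖⁻¹ • x) v, Fin.cases hw hv, ?_⟩
      intro i j hij
      cases i using Fin.cases with
      | zero =>
        cases j using Fin.cases with
        | zero => exact absurd rfl hij
        | succ j => exact (hwU j).symm
      | succ i =>
        cases j using Fin.cases with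
        | zero => exact hwU i
        | succ j => exact hvU i j fun h => hij (congrArg Fin.succ h)
  obtain ⟨v, hv, hvU⟩ := hex (Module.finrank ℝ E + 1)
  have ho : Orthonormal ℝ v :=
    ⟨hv, fun i j hij => (hvU i j hij).inner_eq (hself _) (hself _)⟩
  simpa using ho.linearIndependent.fintype_card_le_finrank

end IsotropicBilinearMap

/-- Proposition 5.11, decomposition (5.18): for an isotropic symmetric bilinear
map `L` satisfying (5.14) on `E` with `dim E ≥ 1`, there are `k₀ ≥ 1` and unit vectors
`v₁,…,v_{k₀}` such that `E` is the orthogonal direct sum of the subspaces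
`span{vᵢ} ⊕ V_{vᵢ}(0)` (where `V_v(0) = {u : u ⊥ v, L(v,u) = 0}`), and `P_{vᵢ} vⱼ = τ·vⱼ`
for `i ≠ j` (`τ = μ₁²/8`). -/
theorem isotropic_bilinear_map_direct_sum_decomposition
    {E F : Type*} [NormedAddCommGroup E] [InnerProductSpace ℝ E] [FiniteDimensional ℝ E]
    [NormedAddCommGroup F] [InnerProductSpace ℝ F] [FiniteDimensional ℝ F]
    (hdim : 1 ≤ Module.finrank ℝ E)
    (μ₁ τ : ℝ) (hμ₁ : 0 < μ₁) (hτ : τ = μ₁ ^ 2 / 8)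
    (L : E →ₗ[ℝ] E →ₗ[ℝ] F) (hsymm : ∀ v w : E, L v w = L w v)
    (hiso : ∀ v : E, ⟪L v v, L v v⟫ = (μ₁ ^ 2 / 4) * ⟪v, v⟫ ^ 2)
    (h514 : ∀ (b : OrthonormalBasis (Fin (Module.finrank ℝ E)) ℝ E) (v₁ v₂ v₃ v₄ : E),
      ∑ i, (⟪L v₁ (b i), L v₃ v₄⟫ • L v₂ (b i) + ⟪L v₂ (b i), L v₃ v₄⟫ • L v₁ (b i)
        - ⟪L v₃ (b i), L v₁ v₂⟫ • L v₄ (b i) - ⟪L v₄ (b i), L v₁ v₂⟫ • L v₃ (b i)) = 0) :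
    ∃ (k₀ : ℕ), 1 ≤ k₀ ∧ ∃ v : Fin k₀ → E,
      (∀ i, ‖v i‖ = 1) ∧
      (∀ i j : Fin k₀, i ≠ j →
        ∀ x ∈ (ℝ ∙ v i) ⊔ ((ℝ ∙ v i)ᗮ ⊓ LinearMap.ker (L (v i))),
        ∀ y ∈ (ℝ ∙ v j) ⊔ ((ℝ ∙ v j)ᗮ ⊓ LinearMap.ker (L (v j))),
          ⟪x, y⟫ = 0) ∧
      (⨆ i : Fin k₀, ((ℝ ∙ v i) ⊔ ((ℝ ∙ v i)ᗮ ⊓ LinearMap.ker (L (v i))))) = ⊤ ∧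
      (∀ i j : Fin k₀, i ≠ j → ∀ u : E,
        ⟪L (v i) (v j), L (v i) u⟫ = τ * ⟪v j, u⟫) := by
  have hc : 0 < μ₁ ^ 2 / 4 := by positivity
  have hL : IsIsotropicSymm L (μ₁ ^ 2 / 4) := ⟨hsymm, hiso⟩
  have hP : ∀ v u : E, ‖v‖ = 1 → ⟪v, u⟫ = 0 →
      L v ((L v).adjoint (L v u)) = (μ₁ ^ 2 / 4 / 2) • L v u := fun v u hv hvu =>
    hL.apply_adjoint_apply (stdOrthonormalBasis ℝ E) (h514 _) hv hvu
  obtain ⟨k, v, hv, hvU, htop⟩ := exists_orthogonal_family_iSup_eq_top (nullSpan L)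
    (self_mem_nullSpan L) fun v w hv hw => hL.nullSpan_isOrtho hP hc hv hw
  refine ⟨k, ?_, v, hv, fun i j hij x hx y hy => (hvU i j hij).inner_eq hx hy, htop, ?_⟩
  · rw [Nat.one_le_iff_ne_zero]
    rintro rfl
    rw [iSup_of_empty] at htop
    rw [← finrank_top ℝ E, ← htop, finrank_bot] at hdim
    exact absurd hdim (by norm_num)
  · intro i j hij u
    have hj : v j ∈ (nullSpan L (v i))ᗮ := (hvU i j hij).symm.le (self_mem_nullSpan L (v j))
    rw [← LinearMap.adjoint_inner_left,
      hL.adjoint_apply_of_mem_orthogonal hP (hv i) hj, real_inner_smul_left, hτ]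
    ring
end

section
/- Let E and F be finite-dimensional real inner product spaces, μ₁ > 0, and L : E × E → F a symmetric bilinear map that is isotropic with constant μ₁²/4 and satisfies identity (5.14). Let v₁ ∈ E be a unit vector. Then: (i) for every unit vector u₁ ∈ span{v₁} ⊕ V_{v₁}(0), one has span{v₁} ⊕ V_{v₁}(0) = span{u₁} ⊕ V_{u₁}(0); and (ii) for any two orthonormal vectors u₁, ũ₁ ∈ span{v₁} ⊕ V_{v₁}(0), one has L(u₁, ũ₁) = 0. -/
open scoped RealInnerProductSpace

namespace LinearMap

variable {E F : Type*} [NormedAddCommGroup E] [InnerProductSpace ℝ E]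
  [NormedAddCommGroup F] [InnerProductSpace ℝ F]

/-- Partial polarization of the isotropy condition. -/
theorem inner_self_add_two_mul_inner_of_isotropic {c : ℝ} {L : E →ₗ[ℝ] E →ₗ[ℝ] F}
    (hsymm : ∀ v w : E, L v w = L w v) (hiso : ∀ v : E, ⟪L v v, L v v⟫ = c * ⟪v, v⟫ ^ 2)
    (v w : E) :
    ⟪L v v, L w w⟫ + 2 * ⟪L v w, L v w⟫ = c * (⟪v, v⟫ * ⟪w, w⟫ + 2 * ⟪v, w⟫ ^ 2) := by
  have hadd := hiso (v + w)
  have hsub := hiso (v - w)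
  simp only [map_add, map_sub, add_apply, sub_apply, inner_add_left, inner_add_right,
    inner_sub_left, inner_sub_right, hsymm w v, real_inner_comm v w,
    real_inner_comm (L v v) (L w w), real_inner_comm (L v v) (L v w),
    real_inner_comm (L v w) (L w w)] at hadd hsub
  linear_combination (hadd + hsub) / 4 - (hiso v + hiso w) / 2

/-- For a unit vector `v`, the block `span {v} ⊕ {u ⊥ v | L v u = 0}` consists of the vectors `w`
with `L v w = ⟪v, w⟫ • L v v`. -/
theorem mem_span_sup_orthogonal_inf_ker_iff {L : E →ₗ[ℝ] E →ₗ[ℝ] F} {v : E} (hv : ‖v‖ = 1)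
    {w : E} :
    w ∈ (ℝ ∙ v) ⊔ ((ℝ ∙ v)ᗮ ⊓ ker (L v)) ↔ L v w = ⟪v, w⟫ • L v v := by
  have hvv : ⟪v, v⟫ = 1 := by simp [hv]
  constructor
  · intro hw
    obtain ⟨x, hx, u, ⟨hu, huL⟩, rfl⟩ := Submodule.mem_sup.mp hw
    obtain ⟨t, rfl⟩ := Submodule.mem_span_singleton.mp hx
    have hvu : ⟪v, u⟫ = 0 := Submodule.mem_orthogonal_singleton_iff_inner_right.mp hu
    have hLvu : L v u = 0 := huL
    simp [inner_add_right, inner_smul_right, hvu, hLvu, hv]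
  · intro hw
    refine Submodule.mem_sup.mpr ⟨⟪v, w⟫ • v,
      Submodule.smul_mem _ _ (Submodule.mem_span_singleton_self v), w - ⟪v, w⟫ • v, ⟨?_, ?_⟩,
      add_sub_cancel _ _⟩
    · refine Submodule.mem_orthogonal_singleton_iff_inner_right.mpr ?_
      rw [inner_sub_right, inner_smul_right, hvv, mul_one, sub_self]
    · change L v (w - ⟪v, w⟫ • v) = 0
      rw [map_sub, map_smul, hw, sub_self]

/-- The equality case of the Cauchy–Schwarz inequality for `L v v` and `L w w`. -/
theorem apply_self_eq_smul_of_isotropic {c : ℝ} {L : E →ₗ[ℝ] E →ₗ[ℝ] F}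
    (hsymm : ∀ v w : E, L v w = L w v) (hiso : ∀ v : E, ⟪L v v, L v v⟫ = c * ⟪v, v⟫ ^ 2)
    {v w : E} (hv : ‖v‖ = 1) (hw : L v w = ⟪v, w⟫ • L v v) :
    L w w = ⟪w, w⟫ • L v v := by
  have hvv : ⟪v, v⟫ = 1 := by simp [hv]
  have hpol := inner_self_add_two_mul_inner_of_isotropic hsymm hiso v w
  have hLv := hiso v
  rw [hw, real_inner_smul_left, real_inner_smul_right, hLv, hvv] at hpol
  rw [hvv] at hLv
  rw [← sub_eq_zero, ← inner_self_eq_zero (𝕜 := ℝ)]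
  simp only [inner_sub_left, inner_sub_right, real_inner_smul_left, real_inner_smul_right,
    real_inner_comm (L v v) (L w w)]
  linear_combination hiso w - 2 * ⟪w, w⟫ * hpol + ⟪w, w⟫ ^ 2 * hLv

/-- On the block of a unit vector `v`, an isotropic map is the inner product times `L v v`. -/
theorem apply_eq_inner_smul_of_isotropic {c : ℝ} {L : E →ₗ[ℝ] E →ₗ[ℝ] F}
    (hsymm : ∀ v w : E, L v w = L w v) (hiso : ∀ v : E, ⟪L v v, L v v⟫ = c * ⟪v, v⟫ ^ 2)
    {v x y : E} (hv : ‖v‖ = 1) (hx : L v x = ⟪v, x⟫ • L v v) (hy : L v y = ⟪v, y⟫ • L v v) :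
    L x y = ⟪x, y⟫ • L v v := by
  have hxx := apply_self_eq_smul_of_isotropic hsymm hiso hv hx
  have hyy := apply_self_eq_smul_of_isotropic hsymm hiso hv hy
  have hadd := apply_self_eq_smul_of_isotropic hsymm hiso (w := x + y) hv
    (by rw [map_add, hx, hy, inner_add_right, add_smul])
  simp only [map_add, add_apply, inner_add_left, inner_add_right, hsymm y x,
    real_inner_comm x y, hxx, hyy] at hadd
  linear_combination (norm := module) (1 / 2 : ℝ) • hadd

/-- The block of a unit vector `v` is contained in the block of each of its unit vectors `u`. -/
theorem apply_eq_inner_smul_self_of_isotropic {c : ℝ} {L : E →ₗ[ℝ] E →ₗ[ℝ] F}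
    (hsymm : ∀ v w : E, L v w = L w v) (hiso : ∀ v : E, ⟪L v v, L v v⟫ = c * ⟪v, v⟫ ^ 2)
    {v u w : E} (hv : ‖v‖ = 1) (hu : ‖u‖ = 1)
    (hvu : L v u = ⟪v, u⟫ • L v v) (hvw : L v w = ⟪v, w⟫ • L v v) :
    L u w = ⟪u, w⟫ • L u u := by
  rw [apply_self_eq_smul_of_isotropic hsymm hiso hv hvu,
    apply_eq_inner_smul_of_isotropic hsymm hiso hv hvu hvw, real_inner_self_eq_norm_sq, hu,
    one_pow, one_smul]

end LinearMap

/-- Lemma 5.12: for an isotropic symmetric bilinear map `L` satisfying (5.14),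
with `S(v) = span{v} ⊕ V_v(0)` (where `V_v(0) = {u : u ⊥ v, L(v,u) = 0}`): (i) for every unit
vector `u₁ ∈ S(v₁)` one has `S(v₁) = S(u₁)`; (ii) for any two orthonormal vectors
`u₁, ũ₁ ∈ S(v₁)` one has `L(u₁,ũ₁) = 0`. -/
theorem isotropic_bilinear_map_block_lemma
    {E F : Type*} [NormedAddCommGroup E] [InnerProductSpace ℝ E] [FiniteDimensional ℝ E]
    [NormedAddCommGroup F] [InnerProductSpace ℝ F] [FiniteDimensional ℝ F]
    (μ₁ : ℝ) (hμ₁ : 0 < μ₁)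
    (L : E →ₗ[ℝ] E →ₗ[ℝ] F) (hsymm : ∀ v w : E, L v w = L w v)
    (hiso : ∀ v : E, ⟪L v v, L v v⟫ = (μ₁ ^ 2 / 4) * ⟪v, v⟫ ^ 2)
    (h514 : ∀ (b : OrthonormalBasis (Fin (Module.finrank ℝ E)) ℝ E) (v₁ v₂ v₃ v₄ : E),
      ∑ i, (⟪L v₁ (b i), L v₃ v₄⟫ • L v₂ (b i) + ⟪L v₂ (b i), L v₃ v₄⟫ • L v₁ (b i)
        - ⟪L v₃ (b i), L v₁ v₂⟫ • L v₄ (b i) - ⟪L v₄ (b i), L v₁ v₂⟫ • L v₃ (b i)) = 0)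
    (S : E → Submodule ℝ E)
    (hS : ∀ v : E, S v = (ℝ ∙ v) ⊔ ((ℝ ∙ v)ᗮ ⊓ LinearMap.ker (L v)))
    (v₁ : E) (hv₁ : ‖v₁‖ = 1) :
    (∀ u₁ : E, u₁ ∈ S v₁ → ‖u₁‖ = 1 → S v₁ = S u₁) ∧
    (∀ u₁ u₁' : E, u₁ ∈ S v₁ → u₁' ∈ S v₁ → ‖u₁‖ = 1 → ‖u₁'‖ = 1 → ⟪u₁, u₁'⟫ = 0 →
      L u₁ u₁' = 0) := by
  have mem_S {v w : E} (hv : ‖v‖ = 1) : w ∈ S v ↔ L v w = ⟪v, w⟫ • L v v := by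
    rw [hS, LinearMap.mem_span_sup_orthogonal_inf_ker_iff hv]
  have S_le {v u : E} (hv : ‖v‖ = 1) (hu : ‖u‖ = 1) (huv : u ∈ S v) : S v ≤ S u :=
    fun _ hw => (mem_S hu).mpr <| LinearMap.apply_eq_inner_smul_self_of_isotropic hsymm hiso hv hu
      ((mem_S hv).mp huv) ((mem_S hv).mp hw)
  have self_mem (v : E) : v ∈ S v := by
    rw [hS]
    exact Submodule.mem_sup_left (Submodule.mem_span_singleton_self v)
  refine ⟨fun u hu hu_norm => ?_, fun u w hu hw _ _ huw => ?_⟩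
  · have hle := S_le hv₁ hu_norm hu
    exact le_antisymm hle (S_le hu_norm hv₁ (hle (self_mem v₁)))
  · rw [LinearMap.apply_eq_inner_smul_of_isotropic hsymm hiso hv₁ ((mem_S hv₁).mp hu)
      ((mem_S hv₁).mp hw), huw, zero_smul]
end

section
/- Let E and F be finite-dimensional real inner product spaces, μ₁ > 0, τ = μ₁²/8, and L : E × E → F a symmetric bilinear map that is isotropic with constant μ₁²/4 and satisfies identity (5.14). Let v₁, v₂ ∈ E be orthonormal vectors with P_{v₁} v₂ = τ·v₂, and let u₂ ∈ E be a unit vector with ⟪u₂, v₂⟫ = 0 and L(v₂, u₂) = 0. Then there exists a unique unit vector u₁ ∈ E with ⟪u₁, v₁⟫ = 0 and L(v₁, u₁) = 0 such that L(u₁, v₂) = L(v₁, u₂); moreover this u₁ also satisfies L(v₁, v₂) = −L(u₁, u₂). -/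
open scoped RealInnerProductSpace

section IsotropicPolarization

variable {E F : Type*} [NormedAddCommGroup E] [InnerProductSpace ℝ E]
  [NormedAddCommGroup F] [InnerProductSpace ℝ F]

/-- First polarization of the isotropy condition. -/
theorem isotropic_inner_self_left (l : ℝ) (L : E →ₗ[ℝ] E →ₗ[ℝ] F)
    (hsymm : ∀ v w : E, L v w = L w v)
    (hiso : ∀ v : E, ⟪L v v, L v v⟫ = l * ⟪v, v⟫ ^ 2) (a b : E) :
    ⟪L a a, L a b⟫ = l * (⟪a, a⟫ * ⟪a, b⟫) := by
  have h1 := hiso (a + b)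
  have h2 := hiso (a - b)
  have h3 := hiso (a + (2 : ℝ) • b)
  have h4 := hiso (a - (2 : ℝ) • b)
  simp only [map_add, map_sub, map_smul, LinearMap.add_apply, LinearMap.sub_apply,
    LinearMap.smul_apply, inner_add_left, inner_add_right, inner_sub_left, inner_sub_right,
    real_inner_smul_left, real_inner_smul_right, hsymm b a, real_inner_comm a b,
    real_inner_comm (L a a) (L a b), real_inner_comm (L a a) (L b b),
    real_inner_comm (L a b) (L b b)] at h1 h2 h3 h4
  linear_combination (1 / 6) * (h1 - h2) - (1 / 48) * (h3 - h4)

/-- Second polarization of the isotropy condition. -/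
theorem isotropic_inner_two_repeated (l : ℝ) (L : E →ₗ[ℝ] E →ₗ[ℝ] F)
    (hsymm : ∀ v w : E, L v w = L w v)
    (hiso : ∀ v : E, ⟪L v v, L v v⟫ = l * ⟪v, v⟫ ^ 2) (a b c : E) :
    ⟪L a a, L b c⟫ + 2 * ⟪L a b, L a c⟫ = l * (⟪a, a⟫ * ⟪b, c⟫ + 2 * (⟪a, b⟫ * ⟪a, c⟫)) := by
  have h1 := isotropic_inner_self_left l L hsymm hiso (a + b) c
  have h2 := isotropic_inner_self_left l L hsymm hiso (a - b) c
  have h3 := isotropic_inner_self_left l L hsymm hiso b c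
  simp only [map_add, map_sub, LinearMap.add_apply, LinearMap.sub_apply,
    inner_add_left, inner_add_right, inner_sub_left, inner_sub_right,
    hsymm b a, real_inner_comm a b] at h1 h2
  linear_combination (1 / 2) * (h1 - h2) - h3

/-- Full polarization of the isotropy condition. -/
theorem isotropic_inner_cyclic (l : ℝ) (L : E →ₗ[ℝ] E →ₗ[ℝ] F)
    (hsymm : ∀ v w : E, L v w = L w v)
    (hiso : ∀ v : E, ⟪L v v, L v v⟫ = l * ⟪v, v⟫ ^ 2) (a b c d : E) :
    ⟪L a b, L c d⟫ + ⟪L a c, L b d⟫ + ⟪L b c, L a d⟫ =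
      l * (⟪a, b⟫ * ⟪c, d⟫ + ⟪a, c⟫ * ⟪b, d⟫ + ⟪b, c⟫ * ⟪a, d⟫) := by
  have h1 := isotropic_inner_two_repeated l L hsymm hiso (a + b) c d
  have h2 := isotropic_inner_two_repeated l L hsymm hiso a c d
  have h3 := isotropic_inner_two_repeated l L hsymm hiso b c d
  simp only [map_add, LinearMap.add_apply, inner_add_left, inner_add_right,
    hsymm b a, real_inner_comm a b] at h1
  linear_combination (1 / 2) * (h1 - h2 - h3)

/-- Orthogonal vectors annihilated by an isotropic `L` have proportional squares. -/
theorem isotropic_apply_self_eq_of_apply_eq_zero (l : ℝ) (L : E →ₗ[ℝ] E →ₗ[ℝ] F)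
    (hsymm : ∀ v w : E, L v w = L w v)
    (hiso : ∀ v : E, ⟪L v v, L v v⟫ = l * ⟪v, v⟫ ^ 2) {v u : E} (hv : ⟪v, v⟫ = 1)
    (huv : ⟪v, u⟫ = 0) (hL : L v u = 0) : L u u = ⟪u, u⟫ • L v v := by
  have h := isotropic_inner_two_repeated l L hsymm hiso v u u
  rw [hL, huv, hv, inner_zero_left] at h
  have hv' := hiso v
  have hu' := hiso u
  rw [← sub_eq_zero, ← inner_self_eq_zero (𝕜 := ℝ)]
  simp only [inner_sub_left, inner_sub_right, real_inner_smul_left, real_inner_smul_right,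
    real_inner_comm (L v v) (L u u)]
  rw [hv] at hv'
  linear_combination hu' + ⟪u, u⟫ ^ 2 * hv' - 2 * ⟪u, u⟫ * h

end IsotropicPolarization

/-- Lemma 5.13, pairing lemma: for an isotropic symmetric bilinear map `L`
satisfying (5.14), orthonormal `v₁, v₂` with `P_{v₁} v₂ = τ·v₂` (`τ = μ₁²/8`), and a unit
vector `u₂ ∈ V_{v₂}(0)`, there is a unique unit vector `u₁ ∈ V_{v₁}(0)` with
`L(u₁,v₂) = L(v₁,u₂)`; moreover this `u₁` satisfies `L(v₁,v₂) = −L(u₁,u₂)`. -/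
theorem isotropic_bilinear_map_pairing_lemma
    {E F : Type*} [NormedAddCommGroup E] [InnerProductSpace ℝ E] [FiniteDimensional ℝ E]
    [NormedAddCommGroup F] [InnerProductSpace ℝ F] [FiniteDimensional ℝ F]
    (μ₁ τ : ℝ) (hμ₁ : 0 < μ₁) (hτ : τ = μ₁ ^ 2 / 8)
    (L : E →ₗ[ℝ] E →ₗ[ℝ] F) (hsymm : ∀ v w : E, L v w = L w v)
    (hiso : ∀ v : E, ⟪L v v, L v v⟫ = (μ₁ ^ 2 / 4) * ⟪v, v⟫ ^ 2)
    (h514 : ∀ (b : OrthonormalBasis (Fin (Module.finrank ℝ E)) ℝ E) (v₁ v₂ v₃ v₄ : E),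
      ∑ i, (⟪L v₁ (b i), L v₃ v₄⟫ • L v₂ (b i) + ⟪L v₂ (b i), L v₃ v₄⟫ • L v₁ (b i)
        - ⟪L v₃ (b i), L v₁ v₂⟫ • L v₄ (b i) - ⟪L v₄ (b i), L v₁ v₂⟫ • L v₃ (b i)) = 0)
    (v₁ v₂ : E) (hv₁ : ‖v₁‖ = 1) (hv₂ : ‖v₂‖ = 1) (hv₁v₂ : ⟪v₁, v₂⟫ = 0)
    (htau : ∀ u : E, ⟪L v₁ v₂, L v₁ u⟫ = τ * ⟪v₂, u⟫)
    (u₂ : E) (hu₂ : ‖u₂‖ = 1) (hu₂v₂ : ⟪u₂, v₂⟫ = 0) (hLu₂ : L v₂ u₂ = 0) :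
    ∃ u₁ : E,
      ((‖u₁‖ = 1 ∧ ⟪u₁, v₁⟫ = 0 ∧ L v₁ u₁ = 0 ∧ L u₁ v₂ = L v₁ u₂) ∧
        L v₁ v₂ = -L u₁ u₂) ∧
      ∀ u₁' : E, (‖u₁'‖ = 1 ∧ ⟪u₁', v₁⟫ = 0 ∧ L v₁ u₁' = 0 ∧ L u₁' v₂ = L v₁ u₂) →
        u₁' = u₁ := by
  obtain ⟨l, hl⟩ : ∃ l : ℝ, l = μ₁ ^ 2 / 4 := ⟨_, rfl⟩
  have hlτ : l = 2 * τ := by rw [hl, hτ]; ring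
  have hτ0 : 0 < τ := by rw [hτ]; positivity
  rw [← hl] at hiso
  have hpol := isotropic_inner_cyclic l L hsymm hiso
  have n1 : ⟪v₁, v₁⟫ = 1 := by rw [real_inner_self_eq_norm_sq, hv₁]; norm_num
  have n2 : ⟪v₂, v₂⟫ = 1 := by rw [real_inner_self_eq_norm_sq, hv₂]; norm_num
  have m2 : ⟪u₂, u₂⟫ = 1 := by rw [real_inner_self_eq_norm_sq, hu₂]; norm_num
  -- `A w` is the symmetric operator representing the quadratic form `⟪L x y, w⟫`.
  obtain ⟨A, hA, hJ⟩ : ∃ A : F → E → E, (∀ w x y, ⟪A w x, y⟫ = ⟪L x y, w⟫) ∧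
      ∀ x y z t, L y (A (L z t) x) + L x (A (L z t) y) =
        L t (A (L x y) z) + L z (A (L x y) t) := by
    let b := stdOrthonormalBasis ℝ E
    refine ⟨fun w x => ∑ i, ⟪L x (b i), w⟫ • b i, fun w x y => ?_, fun x y z t => ?_⟩
    · conv_rhs => rw [← b.sum_repr' y]
      simp only [sum_inner, map_sum, map_smul, real_inner_smul_left]
      exact Finset.sum_congr rfl fun i _ => mul_comm _ _
    · have h := h514 b x y z t
      simp only [Finset.sum_sub_distrib, Finset.sum_add_distrib] at h
      simp only [map_sum, map_smul]
      rw [← sub_eq_zero, ← h]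
      abel
  have hP1 : A (L v₁ v₂) v₁ = τ • v₂ := by
    refine ext_inner_right ℝ fun y => ?_
    rw [hA, real_inner_comm, htau, real_inner_smul_left]
  have hAvv : ∀ v u : E, ⟪v, v⟫ = 1 → ⟪v, u⟫ = 0 →
      A (L v v) u = l • u - (2 : ℝ) • A (L v u) v := by
    intro v u hv hvu
    refine ext_inner_right ℝ fun y => ?_
    simp only [inner_sub_left, real_inner_smul_left, hA]
    have h := hpol v v u y
    rw [hv, hvu] at h
    rw [real_inner_comm (L v v), real_inner_comm (L v u)]
    linear_combination h
  have hAv : ∀ v : E, ⟪v, v⟫ = 1 → A (L v v) v = l • v := by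
    intro v hv
    refine ext_inner_right ℝ fun y => ?_
    rw [hA, real_inner_smul_left, real_inner_comm,
      isotropic_inner_self_left l L hsymm hiso, hv, one_mul]
  have hLP : ∀ v u : E, ⟪v, v⟫ = 1 → ⟪v, u⟫ = 0 → L v (A (L v u) v) = τ • L v u := by
    intro v u hv hvu
    have h := hJ v v v u
    rw [hAvv v u hv hvu, hAv v hv, map_sub, map_smul, map_smul, map_smul, hsymm u v, hlτ] at h
    have h' : (4 : ℝ) • (L v (A (L v u) v) - τ • L v u) = 0 := by
      linear_combination (norm := module) h
    exact sub_eq_zero.mp ((smul_eq_zero.mp h').resolve_left (by norm_num))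
  have hPτ : ∀ v u : E, ⟪v, v⟫ = 1 → ⟪u, u⟫ = 1 → ⟪v, u⟫ = 0 → ⟪L v u, L v u⟫ = τ →
      A (L v u) v = τ • u := by
    intro v u hv hu hvu hn
    have h1 := hLP v u hv hvu
    have h2 : ⟪A (L v u) v, A (L v u) v⟫ = τ * τ := by
      rw [hA, h1, real_inner_smul_left, hn]
    have h3 : ⟪A (L v u) v, u⟫ = τ := by rw [hA, hn]
    rw [← sub_eq_zero, ← inner_self_eq_zero (𝕜 := ℝ)]
    simp only [inner_sub_left, inner_sub_right, real_inner_smul_left, real_inner_smul_right,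
      real_inner_comm (A (L v u) v) u]
    rw [h2, h3, hu]
    ring
  have hn12 : ⟪L v₁ v₂, L v₁ v₂⟫ = τ := by rw [htau, n2, mul_one]
  have h1122 : ⟪L v₁ v₁, L v₂ v₂⟫ = 0 := by
    have h := hpol v₁ v₁ v₂ v₂
    rw [n1, n2, hv₁v₂, hn12] at h
    linear_combination h + hlτ
  have hv₂v₁ : ⟪v₂, v₁⟫ = 0 := by rw [real_inner_comm, hv₁v₂]
  have hv₂u₂ : ⟪v₂, u₂⟫ = 0 := by rw [real_inner_comm, hu₂v₂]
  have hP2 : A (L v₂ v₁) v₂ = τ • v₁ :=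
    hPτ v₂ v₁ n2 n1 hv₂v₁ (by rw [hsymm v₂ v₁, hn12])
  have hv₁u₂ : ⟪v₁, u₂⟫ = 0 := by
    have h := hA (L v₂ v₁) v₂ u₂
    rw [hP2, hLu₂, inner_zero_left, real_inner_smul_left] at h
    exact (mul_eq_zero.mp h).resolve_left hτ0.ne'
  have hsq : L u₂ u₂ = L v₂ v₂ := by
    have h := isotropic_apply_self_eq_of_apply_eq_zero l L hsymm hiso n2 hv₂u₂ hLu₂
    rwa [m2, one_smul] at h
  have hn1u : ⟪L v₁ u₂, L v₁ u₂⟫ = τ := by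
    have h := hpol v₁ v₁ u₂ u₂
    rw [n1, m2, hv₁u₂, hsq, h1122] at h
    linear_combination (1 / 2) * h + (1 / 2) * hlτ
  have hP1u : A (L v₁ u₂) v₁ = τ • u₂ := hPτ v₁ u₂ n1 m2 hv₁u₂ hn1u
  have hA22v₁ : A (L v₂ v₂) v₁ = 0 := by
    rw [hAvv v₂ v₁ n2 hv₂v₁, hP2, hlτ, smul_smul, sub_self]
  have hA0 : A 0 v₂ = 0 := ext_inner_right ℝ fun y => by
    rw [hA, inner_zero_right, inner_zero_left]
  have hA22u₂ : A (L v₂ v₂) u₂ = l • u₂ := by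
    rw [hAvv v₂ u₂ n2 hv₂u₂, hLu₂, hA0, smul_zero, sub_zero]
  obtain ⟨u₁, hu₁⟩ : ∃ u₁ : E, A (L v₁ u₂) v₂ = τ • u₁ :=
    ⟨τ⁻¹ • A (L v₁ u₂) v₂, by rw [smul_inv_smul₀ hτ0.ne']⟩
  have hu₁' : A (L v₁ v₂) u₂ = -(τ • u₁) := by
    rw [← hu₁]
    refine ext_inner_right ℝ fun y => ?_
    rw [inner_neg_left, hA, hA]
    have h := hpol v₁ v₂ u₂ y
    rw [hv₁v₂, hv₁u₂, hv₂u₂, hLu₂, inner_zero_left] at h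
    rw [real_inner_comm (L v₁ v₂), real_inner_comm (L v₁ u₂)]
    linear_combination h
  have e1 : L v₁ u₁ = 0 := by
    have h := hJ v₁ v₂ v₁ u₂
    rw [hP1u, hP1, hu₁, hu₁', map_smul, map_smul, map_smul, map_neg, map_smul, hLu₂,
      hsymm u₂ v₂, hLu₂] at h
    have h' : (2 * τ) • L v₁ u₁ = 0 := by
      linear_combination (norm := module) h
    exact (smul_eq_zero.mp h').resolve_left (by positivity)
  have e2 : L u₁ v₂ = L v₁ u₂ := by
    have h := hJ v₂ v₂ v₁ u₂
    rw [hu₁, hA22v₁, hA22u₂, map_smul, map_smul, map_zero, hlτ, hsymm v₂ u₁] at h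
    have h' : (2 * τ) • (L u₁ v₂ - L v₁ u₂) = 0 := by
      linear_combination (norm := module) h
    exact sub_eq_zero.mp ((smul_eq_zero.mp h').resolve_left (by positivity))
  have e3 : L v₁ v₂ = -L u₁ u₂ := by
    have h := hJ u₂ u₂ v₁ v₂
    rw [hu₁', hsq, hA22v₁, hAv v₂ n2, map_smul, map_neg, map_smul, map_zero, hlτ,
      hsymm u₂ u₁] at h
    have h' : (2 * τ) • (L v₁ v₂ - -L u₁ u₂) = 0 := by
      linear_combination (norm := module) -h
    exact sub_eq_zero.mp ((smul_eq_zero.mp h').resolve_left (by positivity))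
  have e4 : ⟪u₁, v₁⟫ = 0 := by
    have h := hA (L v₁ u₂) v₂ v₁
    rw [hu₁, real_inner_smul_left, hsymm v₂ v₁, htau, hv₂u₂] at h
    exact mul_left_cancel₀ hτ0.ne' h
  have e5 : ‖u₁‖ = 1 := by
    have h := hA (L v₁ u₂) v₂ u₁
    rw [hu₁, real_inner_smul_left, hsymm v₂ u₁, e2, hn1u, real_inner_self_eq_norm_sq] at h
    have h' : ‖u₁‖ ^ 2 = 1 := mul_left_cancel₀ hτ0.ne' (by rw [h, mul_one])
    exact (pow_eq_one_iff_of_nonneg (norm_nonneg u₁) two_ne_zero).mp h'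
  refine ⟨u₁, ⟨⟨e5, e4, e1, e2⟩, e3⟩, ?_⟩
  rintro u ⟨-, hu1, hu2, hu3⟩
  -- The difference is annihilated by both `v₁` and `v₂`, whose squares are orthogonal.
  obtain ⟨d, hd⟩ : ∃ d : E, d = u - u₁ := ⟨_, rfl⟩
  have d1 : L v₁ d = 0 := by rw [hd, map_sub, hu2, e1, sub_zero]
  have d2 : L v₂ d = 0 := by
    rw [hd, map_sub, hsymm v₂ u, hsymm v₂ u₁, hu3, e2, sub_self]
  have o1 : ⟪v₁, d⟫ = 0 := by
    rw [hd, real_inner_comm, inner_sub_left, hu1, e4, sub_zero]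
  have o2 : ⟪v₂, d⟫ = 0 := by
    have h := isotropic_inner_self_left l L hsymm hiso v₂ d
    rw [d2, inner_zero_right, n2, one_mul, hlτ] at h
    exact (mul_eq_zero.mp h.symm).resolve_left (by positivity)
  have s1 := isotropic_apply_self_eq_of_apply_eq_zero l L hsymm hiso n1 o1 d1
  have s2 := isotropic_apply_self_eq_of_apply_eq_zero l L hsymm hiso n2 o2 d2
  have h := hiso d
  nth_rewrite 1 [s1] at h
  rw [s2, real_inner_smul_left, real_inner_smul_right, h1122, mul_zero, mul_zero, hlτ] at h
  have hdd : ⟪d, d⟫ = 0 :=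
    pow_eq_zero_iff two_ne_zero |>.mp ((mul_eq_zero.mp h.symm).resolve_left (by positivity))
  rw [inner_self_eq_zero, hd] at hdd
  exact sub_eq_zero.mp hdd
end
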